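/- arXiv:0712.1237 — 2 statements merged into one kernel-verified Lean document; each statement's English description precedes it below -/
import Mathlib

section
/- Let 0 < m < n and let λ ∈ 𝔫_{(m)}* be a comb supercharacter representative whose graph G_λ is connected and nonempty. Let {l_1 < l_2 < … < l_s} be the set of columns containing nonzero entries of λ, and for 1 ≤ d ≤ s−1 let i_d be the row of the unique nonzero entry of λ in column l_d (so i_1 > i_2 > … > i_{s−1} > 1). Let i* be the largest row index with λ_{i* l_s} ≠ 0. Then: if i* > 1 and i* ∉ {i_1,…,i_{s−1}}, the supercharacter degree is χ^λ(1) = q^{l_s − i* − 1} · ∏_{d=1}^{s−1} q^{l_d − i_d − 1}; otherwise (i.e., if i* = 1 or i* = i_1), χ^λ(1) = q^{l_s − m − 1} · ∏_{d=1}^{s−1} q^{l_d − i_d − 1}. -/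
open Matrix BigOperators
open scoped Classical

/-- `n × n` matrices over `F`. -/
abbrev Mat (n : ℕ) (F : Type*) := Matrix (Fin n) (Fin n) F

section Defs

variable {n : ℕ} {F : Type*} [Field F] [Fintype F]

/-- The pattern group `U_P` attached to a relation `P` on `{0,…,n-1}`:
unipotent upper-triangular matrices supported (off the diagonal) on positions `(i,j)` with `P i j`. -/
def patGroup (P : Fin n → Fin n → Prop) : Set (Mat n F) :=
  {u | (∀ i, u i i = 1) ∧ ∀ i j, i ≠ j → ¬ P i j → u i j = 0}

/-- Truncation of a matrix to the positions allowed by `P` (used to identify a functional on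
`𝔫_P` with the matrix of its coefficients on allowable positions). -/
noncomputable def truncP (P : Fin n → Fin n → Prop) (A : Mat n F) : Mat n F :=
  Matrix.of fun i j => if P i j then A i j else 0

/-- The left orbit `U_P λ` of the functional (identified with a matrix) `lam`:
`(aλ)(x) = λ(a⁻¹ x)`, whose coefficient matrix is the truncation of `(a⁻¹)ᵀ * λ`. -/
noncomputable def dualLeftOrbit (P : Fin n → Fin n → Prop) (lam : Mat n F) : Set (Mat n F) :=
  {mu | ∃ a ∈ (patGroup P : Set (Mat n F)), mu = truncP P ((a⁻¹)ᵀ * lam)}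

/-- The two-sided orbit `U_P λ U_P` of the functional `lam`: `(aλb)(x) = λ(a⁻¹ x b⁻¹)`,
whose coefficient matrix is the truncation of `(a⁻¹)ᵀ * λ * (b⁻¹)ᵀ`. -/
noncomputable def dualOrbit (P : Fin n → Fin n → Prop) (lam : Mat n F) : Set (Mat n F) :=
  {mu | ∃ a ∈ (patGroup P : Set (Mat n F)), ∃ b ∈ (patGroup P : Set (Mat n F)),
    mu = truncP P ((a⁻¹)ᵀ * lam * (b⁻¹)ᵀ)}

/-- The two-sided superclass orbit `{a (v-1) b : a, b ∈ U_P}` attached to `v ∈ U_P`. -/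
def classOrbit (P : Fin n → Fin n → Prop) (v : Mat n F) : Set (Mat n F) :=
  {x | ∃ a ∈ (patGroup P : Set (Mat n F)), ∃ b ∈ (patGroup P : Set (Mat n F)),
    x = a * (v - 1) * b}

/-- The pairing `λ(x) = Σ_{i,j} λ_{ij} x_{ij}` of a functional-matrix with a matrix. -/
def pairM (A B : Mat n F) : F := ∑ i, ∑ j, A i j * B i j

/-- The supercharacter `χ^λ` of the pattern group `U_P` attached to the functional `lam`:
`χ^λ(u) = (|U_Pλ|/|U_PλU_P|) Σ_{μ ∈ U_PλU_P} θ(−μ(u−1))`. -/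
noncomputable def superChar (P : Fin n → Fin n → Prop) (θ : AddChar F ℂ)
    (lam u : Mat n F) : ℂ :=
  ((dualLeftOrbit P lam).ncard : ℂ) / ((dualOrbit P lam).ncard : ℂ) *
    ∑ᶠ mu ∈ dualOrbit P lam, θ (- pairM mu (u - 1))

/-- The full order `i < j`, whose pattern group is `U_n`. -/
def Plt (n : ℕ) : Fin n → Fin n → Prop := fun i j => i < j

/-- The poset `𝒫_(m)` (in 0-based indexing): `i < j`, except that row `0` (row `1` in 1-based
indexing) is only comparable to columns `j` with 1-based value `j+1 > m`.  Its pattern group is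
the interpolating group `U_(m)`. -/
def Pm (n m : ℕ) : Fin n → Fin n → Prop := fun i j => i < j ∧ (i.val = 0 → m < j.val + 1)

/-- `𝒮_n(q)`: strictly upper-triangular matrices with at most one nonzero entry in each row
and each column. -/
def Sset (n : ℕ) (F : Type*) [Field F] : Set (Mat n F) :=
  {lam | (∀ i j : Fin n, ¬ i < j → lam i j = 0) ∧
    (∀ (i j j' : Fin n), lam i j ≠ 0 → lam i j' ≠ 0 → j = j') ∧
    (∀ (i i' j : Fin n), lam i j ≠ 0 → lam i' j ≠ 0 → i = i')}

/-- Adjacency of two nonzero positions of `A` (they share a row or a column): the edges of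
the graph `G_A`. -/
def adjRel (A : Mat n F) (p q : Fin n × Fin n) : Prop :=
  p ≠ q ∧ A p.1 p.2 ≠ 0 ∧ A q.1 q.2 ≠ 0 ∧ (p.1 = q.1 ∨ p.2 = q.2)

/-- The connected component of the position `p` in the graph `G_A`. -/
def compOf (A : Mat n F) (p : Fin n × Fin n) : Set (Fin n × Fin n) :=
  {q | Relation.ReflTransGen (adjRel A) p q}

/-- The set of connected components of the graph `G_A`. -/
def comps (A : Mat n F) : Set (Set (Fin n × Fin n)) :=
  {S | ∃ p : Fin n × Fin n, A p.1 p.2 ≠ 0 ∧ S = compOf A p}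

/-- The matrix agreeing with `A` on the positions of `S` and vanishing elsewhere. -/
noncomputable def restrictTo (S : Set (Fin n × Fin n)) (A : Mat n F) : Mat n F :=
  Matrix.of fun i j => if (i, j) ∈ S then A i j else 0

/-- At most one connected component of `G_A` has more than one vertex. -/
def AtMostOneBig (A : Mat n F) : Prop :=
  ∀ p q : Fin n × Fin n, A p.1 p.2 ≠ 0 → A q.1 q.2 ≠ 0 →
    1 < (compOf A p).ncard → 1 < (compOf A q).ncard → compOf A p = compOf A q

end Defs

section Reps

variable {n : ℕ} {F : Type*} [Field F] [Fintype F]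

/-- The vertex-set shape (in 1-based coordinates `(v.1.val + 1, v.2.val + 1)`) of the large
connected component of a comb superclass representative:
`{(1,k_1),…,(1,k_r)} ∪ {(i_1,k_1),…,(i_{r'},k_{r'})}` with
`1 ≤ i_{r'} < ⋯ < i_1 ≤ m < k_1 < ⋯ < k_r ≤ n` and `r' ∈ {r−1, r}`. -/
def CombClassComp (m : ℕ) (S : Set (Fin n × Fin n)) : Prop :=
  ∃ r r' : ℕ, (r' = r ∨ r' + 1 = r) ∧ 1 ≤ r' ∧
    ∃ i k : ℕ → ℕ,
      (∀ d, 1 ≤ d → d < r' → i (d + 1) < i d) ∧ 1 ≤ i r' ∧ i 1 ≤ m ∧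
      m < k 1 ∧ (∀ d, 1 ≤ d → d < r → k d < k (d + 1)) ∧ k r ≤ n ∧
      S = {v : Fin n × Fin n |
        (v.1.val + 1 = 1 ∧ ∃ d, 1 ≤ d ∧ d ≤ r ∧ v.2.val + 1 = k d) ∨
        (∃ d, 1 ≤ d ∧ d ≤ r' ∧ v.1.val + 1 = i d ∧ v.2.val + 1 = k d)}

/-- `u ∈ U_(m)` is a comb superclass representative (the condition is on `A = u − 1`):
at most one connected component of `G_A` has more than one vertex, and any such component has
the comb shape. -/
def IsCombClassRep (m : ℕ) (A : Mat n F) : Prop :=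
  AtMostOneBig A ∧
    ∀ p : Fin n × Fin n, A p.1 p.2 ≠ 0 → 1 < (compOf A p).ncard →
      CombClassComp m (compOf A p)

/-- The vertex-set shape of the large connected component of a path superclass representative:
`{(1,k_1)} ∪ {(i_d,k_d) : 1 ≤ d ≤ r−1} ∪ {(i_d,k_{d+1}) : 1 ≤ d ≤ r−1} ∪ E` with `E = ∅` or
`E = {(i_r,k_r)}`, where `1 < i_{r'} < ⋯ < i_1 ≤ m < k_1 < ⋯ < k_r ≤ n`, and `r' = r` if
`E ≠ ∅`, `r' = r − 1` if `E = ∅` (`e : Bool` records whether `E ≠ ∅`). -/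
def PathClassComp (m : ℕ) (S : Set (Fin n × Fin n)) : Prop :=
  ∃ (r : ℕ) (e : Bool) (i k : ℕ → ℕ),
    1 ≤ r ∧
    (∀ d, 1 ≤ d → d < (if e then r else r - 1) → i (d + 1) < i d) ∧
    1 < i (if e then r else r - 1) ∧ i 1 ≤ m ∧
    m < k 1 ∧ (∀ d, 1 ≤ d → d < r → k d < k (d + 1)) ∧ k r ≤ n ∧
    S = {v : Fin n × Fin n |
      (v.1.val + 1 = 1 ∧ v.2.val + 1 = k 1) ∨
      (∃ d, 1 ≤ d ∧ d ≤ r - 1 ∧ v.1.val + 1 = i d ∧ v.2.val + 1 = k d) ∨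
      (∃ d, 1 ≤ d ∧ d ≤ r - 1 ∧ v.1.val + 1 = i d ∧ v.2.val + 1 = k (d + 1)) ∨
      (e = true ∧ v.1.val + 1 = i r ∧ v.2.val + 1 = k r)}

/-- `u ∈ U_(m)` is a path superclass representative (the condition is on `A = u − 1`). -/
def IsPathClassRep (m : ℕ) (A : Mat n F) : Prop :=
  AtMostOneBig A ∧
    ∀ p : Fin n × Fin n, A p.1 p.2 ≠ 0 → 1 < (compOf A p).ncard →
      PathClassComp m (compOf A p)

/-- The vertex-set shape of the large connected component of a comb supercharacter
representative: `{(1,k_1)} ∪ {(i_d,k_{d+1}) : 1 ≤ d ≤ r−1} ∪ {(i_d,k_1) : 1 ≤ d ≤ r'}` with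
`n ≥ k_1 > k_2 > ⋯ > k_r > m ≥ i_{r'} > ⋯ > i_1 > 1` and `r' ∈ {r−1, r}`. -/
def CombCharComp (m : ℕ) (S : Set (Fin n × Fin n)) : Prop :=
  ∃ r r' : ℕ, (r' = r ∨ r' + 1 = r) ∧ 1 ≤ r' ∧
    ∃ i k : ℕ → ℕ,
      (∀ d, 1 ≤ d → d < r → k (d + 1) < k d) ∧ m < k r ∧ k 1 ≤ n ∧
      (∀ d, 1 ≤ d → d < r' → i d < i (d + 1)) ∧ i r' ≤ m ∧ 1 < i 1 ∧
      S = {v : Fin n × Fin n |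
        (v.1.val + 1 = 1 ∧ v.2.val + 1 = k 1) ∨
        (∃ d, 1 ≤ d ∧ d ≤ r - 1 ∧ v.1.val + 1 = i d ∧ v.2.val + 1 = k (d + 1)) ∨
        (∃ d, 1 ≤ d ∧ d ≤ r' ∧ v.1.val + 1 = i d ∧ v.2.val + 1 = k 1)}

/-- `λ ∈ 𝔫_(m)^*` is a comb supercharacter representative. -/
def IsCombCharRep (m : ℕ) (A : Mat n F) : Prop :=
  AtMostOneBig A ∧
    ∀ p : Fin n × Fin n, A p.1 p.2 ≠ 0 → 1 < (compOf A p).ncard →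
      CombCharComp m (compOf A p)

/-- The vertex-set shape of the large connected component of a path supercharacter
representative: `{(1,k_1)} ∪ {(i_d,k_d) : 1 ≤ d ≤ r−1} ∪ {(i_d,k_{d+1}) : 1 ≤ d ≤ r−1} ∪ E`
with `E = ∅` or `E = {(i_r,k_r)}`, where `n ≥ k_1 > ⋯ > k_r > m ≥ i_{r'} > ⋯ > i_1 > 1`, and
`r' = r` if `E ≠ ∅`, `r' = r − 1` if `E = ∅`. -/
def PathCharComp (m : ℕ) (S : Set (Fin n × Fin n)) : Prop :=
  ∃ (r : ℕ) (e : Bool) (i k : ℕ → ℕ),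
    1 ≤ r ∧
    (∀ d, 1 ≤ d → d < r → k (d + 1) < k d) ∧ m < k r ∧ k 1 ≤ n ∧
    (∀ d, 1 ≤ d → d < (if e then r else r - 1) → i d < i (d + 1)) ∧
    i (if e then r else r - 1) ≤ m ∧ 1 < i 1 ∧
    S = {v : Fin n × Fin n |
      (v.1.val + 1 = 1 ∧ v.2.val + 1 = k 1) ∨
      (∃ d, 1 ≤ d ∧ d ≤ r - 1 ∧ v.1.val + 1 = i d ∧ v.2.val + 1 = k d) ∨
      (∃ d, 1 ≤ d ∧ d ≤ r - 1 ∧ v.1.val + 1 = i d ∧ v.2.val + 1 = k (d + 1)) ∨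
      (e = true ∧ v.1.val + 1 = i r ∧ v.2.val + 1 = k r)}

/-- `λ ∈ 𝔫_(m)^*` is a path supercharacter representative. -/
def IsPathCharRep (m : ℕ) (A : Mat n F) : Prop :=
  AtMostOneBig A ∧
    ∀ p : Fin n × Fin n, A p.1 p.2 ≠ 0 → 1 < (compOf A p).ncard →
      PathCharComp m (compOf A p)

end Reps

section Helpers

variable {n : ℕ} {F : Type*} [Field F]

lemma one_mem_patGroup (P : Fin n → Fin n → Prop) : (1 : Mat n F) ∈ patGroup P :=
  ⟨fun _ => Matrix.one_apply_eq _, fun _ _ h _ => Matrix.one_apply_ne h⟩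

lemma mul_mem_patGroup {P : Fin n → Fin n → Prop} (hlt : ∀ i j, P i j → i < j)
    (htr : ∀ i j k, P i j → P j k → P i k) {a b : Mat n F}
    (ha : a ∈ patGroup P) (hb : b ∈ patGroup P) : a * b ∈ patGroup P := by
  constructor
  · intro i
    rw [Matrix.mul_apply, Finset.sum_eq_single i]
    · rw [ha.1, hb.1, one_mul]
    · intro k _ hk
      by_cases h : P i k
      · have h' : ¬ P k i := fun h' => lt_asymm (hlt _ _ h) (hlt _ _ h')
        rw [hb.2 k i hk h', mul_zero]
      · rw [ha.2 i k hk.symm h, zero_mul]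
    · simp
  · intro i j hij hP
    rw [Matrix.mul_apply]
    refine Finset.sum_eq_zero fun k _ => ?_
    by_cases hik : i = k
    · subst hik
      rw [hb.2 i j hij hP, mul_zero]
    by_cases h : P i k
    · by_cases hkj : k = j
      · exact absurd (hkj ▸ h) hP
      · rw [hb.2 k j hkj fun h' => hP (htr _ _ _ h h'), mul_zero]
    · rw [ha.2 i k hik h, zero_mul]

lemma pow_mem_patGroup {P : Fin n → Fin n → Prop} (hlt : ∀ i j, P i j → i < j)
    (htr : ∀ i j k, P i j → P j k → P i k) {a : Mat n F} (ha : a ∈ patGroup P) (k : ℕ) :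
    a ^ k ∈ patGroup P := by
  induction k with
  | zero => simpa using one_mem_patGroup P
  | succ k ih => rw [pow_succ]; exact mul_mem_patGroup hlt htr ih ha

lemma det_of_mem_patGroup {P : Fin n → Fin n → Prop} (hlt : ∀ i j, P i j → i < j)
    {a : Mat n F} (ha : a ∈ patGroup P) : a.det = 1 := by
  rw [Matrix.det_of_isUpperTriangular]
  · simp [ha.1]
  · intro i j hij
    exact ha.2 i j (ne_of_gt hij) fun h => lt_asymm (hlt _ _ h) hij

lemma inv_mem_patGroup [Fintype F] {P : Fin n → Fin n → Prop} (hlt : ∀ i j, P i j → i < j)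
    (htr : ∀ i j k, P i j → P j k → P i k) {a : Mat n F} (ha : a ∈ patGroup P) :
    a⁻¹ ∈ patGroup P := by
  have hu : IsUnit a := by
    rw [Matrix.isUnit_iff_isUnit_det, det_of_mem_patGroup hlt ha]
    exact isUnit_one
  obtain ⟨u, rfl⟩ := hu
  obtain ⟨k, hk, hk1⟩ := isOfFinOrder_iff_pow_eq_one.1 (isOfFinOrder_of_finite u)
  have : (u : Mat n F)⁻¹ = (u : Mat n F) ^ (k - 1) := by
    apply Matrix.inv_eq_left_inv
    rw [← pow_succ, Nat.sub_add_cancel hk, ← Units.val_pow_eq_pow_val, hk1, Units.val_one]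
  rw [this]
  exact pow_mem_patGroup hlt htr ha _

lemma dualLeftOrbit_eq [Fintype F] {P : Fin n → Fin n → Prop} (hlt : ∀ i j, P i j → i < j)
    (htr : ∀ i j k, P i j → P j k → P i k) (lam : Mat n F) :
    dualLeftOrbit P lam = {mu | ∃ X : Mat n F, (∀ i j, ¬ P i j → X i j = 0) ∧
      mu = truncP P (lam + Xᵀ * lam)} := by
  have hirr : ∀ i, ¬ P i i := fun i h => lt_irrefl _ (hlt _ _ h)
  ext mu
  constructor
  · rintro ⟨a, ha, rfl⟩
    have hb := inv_mem_patGroup hlt htr ha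
    refine ⟨a⁻¹ - 1, fun i j hij => ?_, ?_⟩
    · by_cases h : i = j
      · subst h
        simp [hb.1]
      · simp [hb.2 i j h hij, Matrix.one_apply_ne h]
    · rw [Matrix.transpose_sub, Matrix.transpose_one, sub_mul, one_mul, add_sub_cancel]
  · rintro ⟨X, hX, rfl⟩
    have hb : (1 + X) ∈ patGroup P := by
      refine ⟨fun i => ?_, fun i j h hij => ?_⟩
      · simp [hX i i (hirr i)]
      · simp [hX i j hij, Matrix.one_apply_ne h]
    refine ⟨(1 + X)⁻¹, inv_mem_patGroup hlt htr hb, ?_⟩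
    rw [Matrix.nonsing_inv_nonsing_inv, Matrix.transpose_add, Matrix.transpose_one, add_mul,
      one_mul]
    rw [det_of_mem_patGroup hlt hb]
    exact isUnit_one

/-- The degree of a supercharacter is the size of the left orbit. -/
lemma superChar_one [Fintype F] (P : Fin n → Fin n → Prop) (θ : AddChar F ℂ) (lam : Mat n F) :
    superChar P θ lam 1 = ((dualLeftOrbit P lam).ncard : ℂ) := by
  have hfin : (dualOrbit P lam).Finite := Set.toFinite _
  have hne : (dualOrbit P lam).Nonempty :=
    ⟨_, 1, one_mem_patGroup P, 1, one_mem_patGroup P, rfl⟩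
  have hcard : ((dualOrbit P lam).ncard : ℂ) ≠ 0 := by
    exact_mod_cast (Set.ncard_pos hfin).2 hne |>.ne'
  have hsum : ∑ᶠ mu ∈ dualOrbit P lam, θ (- pairM mu ((1 : Mat n F) - 1))
      = ((dualOrbit P lam).ncard : ℂ) := by
    rw [finsum_mem_eq_finite_toFinset_sum _ hfin, Set.ncard_eq_toFinset_card _ hfin]
    simp [pairM]
  rw [superChar, hsum, div_mul_cancel₀ _ hcard]

/-- If, for every `j`, the rows `lam (ρ d)` with `(d, j) ∈ T`, truncated to the columns `c` with
`P j c`, form a basis of the span of the truncated rows `lam i` with `P i j`, then the left orbit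
of `lam` has `q ^ |T|` elements. -/
lemma ncard_dualLeftOrbit [Fintype F] {ι : Type*} {P : Fin n → Fin n → Prop} (hlt : ∀ i j, P i j → i < j)
    (htr : ∀ i j k, P i j → P j k → P i k) (lam : Mat n F)
    (T : Finset (Σ _ : ι, Fin n)) (ρ : ι → Fin n) (hT : ∀ t ∈ T, P (ρ t.1) t.2)
    (hspan : ∀ i j, P i j → ∃ y : T → F, ∀ c, P j c →
      lam i c = ∑ t : T, if t.1.2 = j then y t * lam (ρ t.1.1) c else 0)
    (hind : ∀ x : T → F, (∀ j c, P j c →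
      (∑ t : T, if t.1.2 = j then x t * lam (ρ t.1.1) c else 0) = 0) → x = 0) :
    (dualLeftOrbit P lam).ncard = Fintype.card F ^ T.card := by
  let Φ : (T → F) → Mat n F := fun x => Matrix.of fun j c =>
    if P j c then lam j c + ∑ t : T, (if t.1.2 = j then x t * lam (ρ t.1.1) c else 0) else 0
  have hΦ : Function.Injective Φ := by
    intro x x' h
    rw [← sub_eq_zero]
    refine hind _ fun j c hjc => ?_
    have := congrFun (congrFun h j) c
    simp only [Φ, Matrix.of_apply, hjc, if_true, add_right_inj] at this
    rw [← sub_eq_zero, ← Finset.sum_sub_distrib] at this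
    refine Eq.trans ?_ this
    refine Finset.sum_congr rfl fun t _ => ?_
    split_ifs
    · rw [← sub_mul, Pi.sub_apply]
    · rw [sub_zero]
  have hrange : dualLeftOrbit P lam = Set.range Φ := by
    rw [dualLeftOrbit_eq hlt htr]
    ext mu
    constructor
    · rintro ⟨X, hX, rfl⟩
      choose y hy using hspan
      refine ⟨fun t => ∑ i, if h : P i t.1.2 then X i t.1.2 * y i t.1.2 h t else 0, ?_⟩
      ext j c
      simp only [Φ, truncP, Matrix.of_apply]
      split_ifs with hjc
      · rw [Matrix.add_apply, Matrix.mul_apply]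
        congr 1
        have h1 : ∀ i, Xᵀ j i * lam i c = ∑ t : T, if t.1.2 = j then
            (if h : P i t.1.2 then X i t.1.2 * y i t.1.2 h t else 0) * lam (ρ t.1.1) c else 0 := by
          intro i
          rw [Matrix.transpose_apply]
          by_cases hij : P i j
          · rw [hy i j hij c hjc, Finset.mul_sum]
            refine Finset.sum_congr rfl fun t _ => ?_
            split_ifs with h1 h2
            · subst h1
              ring
            · exact absurd (h1 ▸ hij) h2
            · simp
          · rw [hX i j hij, zero_mul]
            refine (Finset.sum_eq_zero fun t _ => ?_).symm
            split_ifs with h1 h2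
            · exact absurd (h1 ▸ h2) hij
            · simp
            · rfl
        simp_rw [h1]
        rw [Finset.sum_comm]
        refine Finset.sum_congr rfl fun t _ => ?_
        split_ifs
        · rw [Finset.sum_mul]
        · simp
      · rfl
    · rintro ⟨x, rfl⟩
      refine ⟨Matrix.of fun i j => ∑ t : T, if ρ t.1.1 = i ∧ t.1.2 = j then x t else 0, ?_, ?_⟩
      · intro i j hij
        rw [Matrix.of_apply]
        refine Finset.sum_eq_zero fun t _ => if_neg ?_
        rintro ⟨rfl, rfl⟩
        exact hij (hT t.1 t.2)
      · ext j c
        simp only [Φ, truncP, Matrix.of_apply]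
        split_ifs with hjc
        · rw [Matrix.add_apply, Matrix.mul_apply]
          congr 1
          simp only [Matrix.transpose_apply, Matrix.of_apply, Finset.sum_mul]
          rw [Finset.sum_comm]
          refine Finset.sum_congr rfl fun t _ => ?_
          rw [Finset.sum_eq_single (ρ t.1.1)]
          · by_cases h : t.1.2 = j
            · rw [if_pos h, if_pos ⟨rfl, h⟩]
            · rw [if_neg h, if_neg fun h' => h h'.2, zero_mul]
          · intro b _ hb
            rw [if_neg (fun h => hb h.1.symm), zero_mul]
          · exact fun h => absurd (Finset.mem_univ _) h
        · rfl
  rw [hrange, ← Set.image_univ, Set.ncard_image_of_injective _ hΦ, Set.ncard_univ,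
    Nat.card_eq_fintype_card]
  simp

lemma Pm_lt {m : ℕ} (i j : Fin n) (h : Pm n m i j) : i < j := h.1

lemma Pm_trans {m : ℕ} (i j k : Fin n) (h : Pm n m i j) (h' : Pm n m j k) : Pm n m i k := by
  refine ⟨h.1.trans h'.1, fun hi => (h.2 hi).trans ?_⟩
  have := h'.1
  rw [Fin.lt_def] at this
  omega

lemma card_filter_Pm_of_pos {m : ℕ} (a L : Fin n) (ha : 1 ≤ a.val) :
    (Finset.univ.filter fun j => Pm n m a j ∧ j < L).card = L.val - a.val - 1 := by
  rw [← Fin.card_Ioo]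
  congr 1
  ext j
  rw [Finset.mem_filter, Finset.mem_Ioo]
  simp only [Finset.mem_univ, true_and, Pm]
  constructor
  · exact fun h => ⟨h.1.1, h.2⟩
  · exact fun h => ⟨⟨h.1, fun h0 => by omega⟩, h.2⟩

lemma card_filter_Pm_zero {m : ℕ} (hm : 0 < m) (hmn : m < n) (a L : Fin n) (ha : a.val = 0) :
    (Finset.univ.filter fun j => Pm n m a j ∧ j < L).card = L.val - m := by
  have : L.val - m = (Finset.Ico (⟨m, hmn⟩ : Fin n) L).card := by rw [Fin.card_Ico]
  rw [this]
  congr 1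
  ext j
  rw [Finset.mem_filter, Finset.mem_Ico]
  simp only [Finset.mem_univ, true_and, Pm, Fin.lt_def, Fin.le_def]
  omega

/-- The size of the left orbit when `lam` has a pivot in each row `i d`, `1 ≤ d < s`, alone in its
column, together with a pivot row `p` supported on the last column `l s`. -/
lemma ncard_dualLeftOrbit_of_pivots [Fintype F] {m s : ℕ} (hs : 1 ≤ s) {lam : Mat n F}
    {l i : ℕ → Fin n} {p : Fin n}
    (hlmono : ∀ d, 1 ≤ d → d < s → l d < l s)
    (hlset : ∀ a c, lam a c ≠ 0 → ∃ d, 1 ≤ d ∧ d ≤ s ∧ c = l d)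
    (hi : ∀ d, 1 ≤ d → d < s →
      lam (i d) (l d) ≠ 0 ∧ ∀ i' : Fin n, lam i' (l d) ≠ 0 → i' = i d)
    (hinj : ∀ d d', 1 ≤ d → d < s → 1 ≤ d' → d' < s → i d = i d' → d = d')
    (hp : lam p (l s) ≠ 0) (hp_row : ∀ c, lam p c ≠ 0 → c = l s)
    (hp_ne : ∀ d, 1 ≤ d → d < s → p ≠ i d)
    (hp_span : ∀ a j, lam a (l s) ≠ 0 → Pm n m a j →
      Pm n m p j ∨ ∃ d, 1 ≤ d ∧ d < s ∧ a = i d ∧ j < l d) :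
    (dualLeftOrbit (Pm n m) lam).ncard =
      Fintype.card F ^ (Finset.univ.filter fun j => Pm n m p j ∧ j < l s).card *
      ∏ d ∈ Finset.Icc 1 (s - 1),
        Fintype.card F ^ (Finset.univ.filter fun j => Pm n m (i d) j ∧ j < l d).card := by
  let ρ : ℕ → Fin n := fun d => if d = s then p else i d
  have hρs : ρ s = p := if_pos rfl
  have hρ : ∀ d, d < s → ρ d = i d := fun d hd => if_neg hd.ne
  let T : Finset (Σ _ : ℕ, Fin n) := (Finset.Icc 1 s).sigma fun d =>
    Finset.univ.filter fun j => Pm n m (ρ d) j ∧ j < l d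
  have hmem : ∀ d j, (⟨d, j⟩ : Σ _ : ℕ, Fin n) ∈ T ↔
      (1 ≤ d ∧ d ≤ s) ∧ Pm n m (ρ d) j ∧ j < l d := by
    intro d j
    simp [T]
  have hsingle : ∀ (u : T) (a : F) (c : Fin n),
      (∑ t : T, if t.1.2 = u.1.2 then (Pi.single u a : T → F) t * lam (ρ t.1.1) c else 0)
        = a * lam (ρ u.1.1) c := by
    intro u a c
    rw [Finset.sum_eq_single u]
    · simp
    · intro t _ ht
      simp [Pi.single_eq_of_ne ht]
    · simp
  have key := ncard_dualLeftOrbit Pm_lt Pm_trans lam T ρ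
    (fun t ht => ((hmem t.1 t.2).1 ht).2.1) ?_ ?_
  · rw [key, Finset.card_sigma, ← Finset.prod_pow_eq_pow_sum]
    obtain ⟨s', rfl⟩ : ∃ s', s = s' + 1 := ⟨s - 1, by omega⟩
    rw [Finset.prod_Icc_succ_top (by omega), mul_comm, hρs, Nat.add_sub_cancel]
    congr 1
    refine Finset.prod_congr rfl fun d hd => ?_
    rw [hρ d (by rw [Finset.mem_Icc] at hd; omega)]
  · intro a j haj
    by_cases hd : ∃ d, 1 ≤ d ∧ d < s ∧ a = i d ∧ j < l d
    · obtain ⟨d, h1, h2, rfl, h3⟩ := hd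
      have ht : (⟨d, j⟩ : Σ _ : ℕ, Fin n) ∈ T :=
        (hmem d j).2 ⟨⟨h1, h2.le⟩, by rwa [hρ d h2], h3⟩
      refine ⟨Pi.single ⟨_, ht⟩ 1, fun c _ => ?_⟩
      rw [hsingle ⟨_, ht⟩ 1 c, one_mul, hρ d h2]
    · have hz : ∀ c, j < c → c ≠ l s → lam a c = 0 := by
        intro c hjc hc
        by_contra h
        obtain ⟨d, h1, h2, rfl⟩ := hlset a c h
        have h3 : d < s := lt_of_le_of_ne h2 fun h => hc (by rw [h])
        exact hd ⟨d, h1, h3, (hi d h1 h3).2 a h, hjc⟩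
      by_cases hL : lam a (l s) ≠ 0 ∧ j < l s
      · have hpj : Pm n m p j := (hp_span a j hL.1 haj).resolve_right hd
        have ht : (⟨s, j⟩ : Σ _ : ℕ, Fin n) ∈ T :=
          (hmem s j).2 ⟨⟨hs, le_rfl⟩, by rwa [hρs], hL.2⟩
        refine ⟨Pi.single ⟨_, ht⟩ (lam a (l s) / lam p (l s)), fun c hc => ?_⟩
        rw [hsingle ⟨_, ht⟩ _ c, hρs]
        by_cases hcs : c = l s
        · rw [hcs, div_mul_cancel₀ _ hp]
        · rw [hz c hc.1 hcs, not_not.1 fun h => hcs (hp_row c h), mul_zero]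
      · refine ⟨0, fun c hc => ?_⟩
        simp only [Pi.zero_apply, zero_mul, ite_self, Finset.sum_const_zero]
        by_cases hcs : c = l s
        · by_contra h
          exact hL ⟨hcs ▸ h, hcs ▸ hc.1⟩
        · exact hz c hc.1 hcs
  · intro x hx
    have hPj : ∀ t : T, Pm n m t.1.2 (l t.1.1) := by
      intro t
      obtain ⟨-, h1, h2⟩ := (hmem t.1.1 t.1.2).1 t.2
      refine ⟨h2, fun h0 => ?_⟩
      have := h1.1
      rw [Fin.lt_def] at this
      omega
    have hlow : ∀ t : T, t.1.1 < s → x t = 0 := by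
      intro t hts
      have h1 := ((hmem t.1.1 t.1.2).1 t.2).1.1
      have hxt := hx t.1.2 (l t.1.1) (hPj t)
      rw [Finset.sum_eq_single t] at hxt
      · rw [if_pos rfl, hρ _ hts] at hxt
        exact (mul_eq_zero.1 hxt).resolve_right (hi _ h1 hts).1
      · intro u _ hut
        split_ifs with huj
        · rw [mul_eq_zero]
          right
          by_contra h
          have h2 := (hi _ h1 hts).2 _ h
          have h3 := ((hmem u.1.1 u.1.2).1 u.2).1
          rcases eq_or_lt_of_le h3.2 with h4 | h4
          · rw [h4, hρs] at h2
            exact hp_ne _ h1 hts h2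
          · rw [hρ _ h4] at h2
            have h5 := hinj _ _ h3.1 h4 h1 hts h2
            exact hut (Subtype.ext (Sigma.ext h5 (heq_of_eq huj)))
        · rfl
      · simp
    funext t
    have h3 := ((hmem t.1.1 t.1.2).1 t.2).1
    rcases eq_or_lt_of_le h3.2 with h4 | h4
    · have hxt := hx t.1.2 (l t.1.1) (hPj t)
      rw [Finset.sum_eq_single t] at hxt
      · rw [if_pos rfl, h4, hρs] at hxt
        exact (mul_eq_zero.1 hxt).resolve_right hp
      · intro u _ hut
        split_ifs with huj
        · have h5 := ((hmem u.1.1 u.1.2).1 u.2).1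
          have h6 : u.1.1 ≠ s := fun h =>
            hut (Subtype.ext (Sigma.ext (h.trans h4.symm) (heq_of_eq huj)))
          rw [hlow u (by omega), zero_mul]
        · rfl
      · simp
    · exact hlow t h4

lemma ne_zero_of_mem_compOf {A : Mat n F} {p q : Fin n × Fin n} (hp : A p.1 p.2 ≠ 0)
    (h : q ∈ compOf A p) : A q.1 q.2 ≠ 0 := by
  rcases Relation.ReflTransGen.cases_tail h with rfl | ⟨_, _, h⟩
  · exact hp
  · exact h.2.2.1

lemma lt_of_step_lt {f : ℕ → ℕ} {b : ℕ} (h : ∀ d, 1 ≤ d → d < b → f d < f (d + 1))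
    {d e : ℕ} (hd : 1 ≤ d) (hde : d < e) (he : e ≤ b) : f d < f e := by
  induction e, hde using Nat.le_induction with
  | base => exact h d hd (by omega)
  | succ e hde ih => exact (ih (by omega)).trans (h e (by omega) (by omega))

/-- The shape of a connected comb supercharacter representative, seen from the last nonzero
column `L` and the last nonzero row `r` of that column. -/
structure IsCombShape (m : ℕ) (lam : Mat n F) (L r : Fin n) : Prop where
  col_unique : ∀ a c c', lam a c ≠ 0 → lam a c' ≠ 0 → c ≠ L → c' ≠ L → c = c'
  row_pos : ∀ a c, lam a c ≠ 0 → c ≠ L → 1 ≤ a.val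
  le_col : ∀ a c, lam a c ≠ 0 → c ≠ L → m ≤ c.val
  exists_col : ∀ a, lam a L ≠ 0 → a.val ≠ 0 → a ≠ r → ∃ c, c ≠ L ∧ lam a c ≠ 0
  row_lt : ∀ a c, lam a c ≠ 0 → a ≠ r → r.val < m
  zero_row : ∀ c, c ≠ L → lam r c ≠ 0 → ∀ z : Fin n, z.val = 0 → lam z L ≠ 0

lemma isCombShape_of_connected {m : ℕ} (hm : 0 < m) (hmn : m < n) {lam : Mat n F}
    (hcomb : IsCombCharRep m lam) {L r : Fin n} (hr : lam r L ≠ 0)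
    (hr_max : ∀ a, lam a L ≠ 0 → a ≤ r) (hL : ∀ a c, lam a c ≠ 0 → c ≤ L)
    (hconn : ∀ p q : Fin n × Fin n, lam p.1 p.2 ≠ 0 → lam q.1 q.2 ≠ 0 → q ∈ compOf lam p) :
    IsCombShape m lam L r := by
  by_cases hbig : 1 < (compOf lam (r, L)).ncard
  · obtain ⟨R, R', hRR, hR', i, k, hk, hmk, hkn, hi, him, hi1, hS⟩ :=
      hcomb.2 (r, L) hr hbig
    have hmem : ∀ a c, lam a c ≠ 0 ↔ ((a.val + 1 = 1 ∧ c.val + 1 = k 1) ∨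
        (∃ d, 1 ≤ d ∧ d ≤ R - 1 ∧ a.val + 1 = i d ∧ c.val + 1 = k (d + 1)) ∨
        (∃ d, 1 ≤ d ∧ d ≤ R' ∧ a.val + 1 = i d ∧ c.val + 1 = k 1)) := by
      intro a c
      have h1 : lam a c ≠ 0 ↔ (a, c) ∈ compOf lam (r, L) :=
        ⟨fun h => hconn _ (a, c) hr h, fun h => ne_zero_of_mem_compOf (A := lam) hr h⟩
      rw [h1, hS]
      rfl
    have hk_lt : ∀ d e, 1 ≤ d → d < e → e ≤ R → k e < k d := by
      intro d e hd hde he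
      induction e, hde using Nat.le_induction with
      | base => exact hk d hd (by omega)
      | succ e hde ih => exact (hk e (by omega) (by omega)).trans (ih (by omega))
    have hi_lt : ∀ d e, 1 ≤ d → d < e → e ≤ R' → i d < i e :=
      fun d e hd hde he => lt_of_step_lt hi hd hde he
    have hmk' : ∀ d, 1 ≤ d → d ≤ R → m < k d := by
      intro d hd hdR
      rcases eq_or_lt_of_le hdR with rfl | h
      · exact hmk
      · exact hmk.trans (hk_lt d R hd h le_rfl)
    have hi1' : ∀ d, 1 ≤ d → d ≤ R' → 1 < i d := by
      intro d hd hdR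
      rcases eq_or_lt_of_le hd with rfl | h
      · exact hi1
      · exact hi1.trans (hi_lt 1 d le_rfl h hdR)
    have him' : ∀ d, 1 ≤ d → d ≤ R' → i d ≤ i R' := by
      intro d hd hdR
      rcases eq_or_lt_of_le hdR with rfl | h
      · exact le_rfl
      · exact (hi_lt d R' hd h le_rfl).le
    have hk1 := hmk' 1 le_rfl (by omega)
    have hLk : L.val + 1 = k 1 := by
      have h1 := hL ⟨0, by omega⟩ ⟨k 1 - 1, by omega⟩
        ((hmem _ _).2 (Or.inl ⟨rfl, by simp only; omega⟩))
      rw [Fin.le_def] at h1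
      simp only at h1
      rcases (hmem r L).1 hr with h | ⟨d, hd1, hd2, -, h⟩ | ⟨d, -, -, -, h⟩
      · exact h.2
      · have := hk_lt 1 (d + 1) le_rfl (by omega) (by omega)
        omega
      · exact h
    have hoff : ∀ a c, lam a c ≠ 0 → c ≠ L →
        ∃ d, 1 ≤ d ∧ d ≤ R - 1 ∧ a.val + 1 = i d ∧ c.val + 1 = k (d + 1) := by
      intro a c h hc
      have hc' : c.val + 1 ≠ k 1 := fun h => hc (Fin.ext (by omega))
      rcases (hmem a c).1 h with h | h | ⟨d, -, -, -, h⟩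
      · exact absurd h.2 hc'
      · exact h
      · exact absurd h hc'
    refine ⟨?_, ?_, ?_, ?_, ?_, ?_⟩
    · intro a c c' h h' hc hc'
      obtain ⟨d, hd1, hd2, ha, hcd⟩ := hoff a c h hc
      obtain ⟨e, he1, he2, ha', hce⟩ := hoff a c' h' hc'
      have hde : d = e := by
        rcases lt_trichotomy d e with hlt | heq | hlt
        · have := hi_lt d e hd1 hlt (by omega)
          omega
        · exact heq
        · have := hi_lt e d he1 hlt (by omega)
          omega
      subst hde
      exact Fin.ext (by omega)
    · intro a c h hc
      obtain ⟨d, hd1, hd2, ha, hcd⟩ := hoff a c h hc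
      have := hi1' d hd1 (by omega)
      omega
    · intro a c h hc
      obtain ⟨d, hd1, hd2, ha, hcd⟩ := hoff a c h hc
      have := hmk' (d + 1) (by omega) (by omega)
      omega
    · intro a h ha0 har
      have har' : a.val < r.val := lt_of_le_of_ne (hr_max a h) fun h => har (Fin.ext h)
      have hrow : ∀ b, lam b L ≠ 0 → b.val ≠ 0 → ∃ d, 1 ≤ d ∧ d ≤ R' ∧ b.val + 1 = i d := by
        intro b hb hb0
        rcases (hmem b L).1 hb with h | ⟨d, hd1, hd2, hd, -⟩ | ⟨d, hd1, hd2, hd, -⟩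
        · omega
        · exact ⟨d, hd1, by omega, hd⟩
        · exact ⟨d, hd1, hd2, hd⟩
      obtain ⟨d, hd1, hd2, hd⟩ := hrow a h ha0
      obtain ⟨e, he1, he2, he⟩ := hrow r hr (by omega)
      have hdR : d ≤ R - 1 := by
        by_contra hlt
        have hdR' : d = R' := by omega
        have := him' e he1 he2
        rw [hdR'] at hd
        omega
      have h1 := hk_lt 1 (d + 1) le_rfl (by omega) (by omega)
      have h2 := hmk' (d + 1) (by omega) (by omega)
      refine ⟨⟨k (d + 1) - 1, by omega⟩, fun hc => ?_, (hmem _ _).2 (Or.inr (Or.inl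
        ⟨d, hd1, hdR, hd, by simp only; omega⟩))⟩
      have := congrArg Fin.val hc
      simp only at this
      omega
    · intro a c _ _
      rcases (hmem r L).1 hr with h | ⟨d, hd1, hd2, hd, -⟩ | ⟨d, hd1, hd2, hd, -⟩
      · omega
      · have := him' d hd1 (by omega)
        omega
      · have := him' d hd1 hd2
        omega
    · intro _ _ _ z hz
      exact (hmem z L).2 (Or.inl ⟨by omega, hLk⟩)
  · have hone : ∀ a c, lam a c ≠ 0 → a = r ∧ c = L := by
      intro a c h
      have h1 := (Set.ncard_le_one (Set.toFinite _)).1 (not_lt.1 hbig) (a, c)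
        (hconn (r, L) (a, c) hr h) (r, L) Relation.ReflTransGen.refl
      exact ⟨congrArg Prod.fst h1, congrArg Prod.snd h1⟩
    refine ⟨?_, ?_, ?_, ?_, ?_, ?_⟩
    · exact fun a c _ h _ hc => absurd (hone a c h).2 hc
    · exact fun a c h hc => absurd (hone a c h).2 hc
    · exact fun a c h hc => absurd (hone a c h).2 hc
    · exact fun a h _ ha => absurd (hone a L h).1 ha
    · exact fun a c h ha => absurd (hone a c h).1 ha
    · exact fun c hc h => absurd (hone r c h).2 hc

end Helpers

/-- Degree of the supercharacter of `U_(m)` attached to a comb supercharacter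
representative `λ` whose graph `G_λ` is connected and nonempty.  With 1-based columns
`l_1 < ⋯ < l_s` of nonzero entries (here `l d : Fin n`, 0-based), `i_d` the row of the unique
nonzero entry in column `l_d` (`d ≤ s−1`) and `i*` the largest row with `λ_{i* l_s} ≠ 0`:
if `i* > 1` and `i* ∉ {i_1,…,i_{s−1}}` then
`χ^λ(1) = q^{l_s−i*−1} ∏_{d=1}^{s−1} q^{l_d−i_d−1}`, and otherwise
`χ^λ(1) = q^{l_s−m−1} ∏_{d=1}^{s−1} q^{l_d−i_d−1}`. -/
theorem stmt17 {n m : ℕ} (hm : 0 < m) (hmn : m < n) {F : Type*} [Field F] [Fintype F]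
    (θ : AddChar F ℂ) (hθ : ∃ x, θ x ≠ 1)
    (lam : Mat n F) (hsupp : ∀ i j : Fin n, ¬ Pm n m i j → lam i j = 0)
    (hcomb : IsCombCharRep m lam)
    (hne : ∃ p : Fin n × Fin n, lam p.1 p.2 ≠ 0)
    (hconn : ∀ p q : Fin n × Fin n, lam p.1 p.2 ≠ 0 → lam q.1 q.2 ≠ 0 → q ∈ compOf lam p)
    (s : ℕ) (l : ℕ → Fin n)
    (hlmono : ∀ d, 1 ≤ d → d < s → l d < l (d + 1))
    (hlset : ∀ c : Fin n, (∃ i, lam i c ≠ 0) ↔ ∃ d, 1 ≤ d ∧ d ≤ s ∧ c = l d)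
    (i : ℕ → Fin n)
    (hi : ∀ d, 1 ≤ d → d ≤ s - 1 →
      lam (i d) (l d) ≠ 0 ∧ ∀ i' : Fin n, lam i' (l d) ≠ 0 → i' = i d)
    (istar : Fin n)
    (histar : lam istar (l s) ≠ 0 ∧ ∀ i' : Fin n, lam i' (l s) ≠ 0 → i' ≤ istar) :
    ((1 ≤ istar.val ∧ ∀ d, 1 ≤ d → d ≤ s - 1 → istar ≠ i d) →
      superChar (Pm n m) θ lam 1 =
        (Fintype.card F : ℂ) ^ ((l s).val - istar.val - 1) *
          ∏ d ∈ Finset.Icc 1 (s - 1),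
            (Fintype.card F : ℂ) ^ ((l d).val - (i d).val - 1)) ∧
    (¬(1 ≤ istar.val ∧ ∀ d, 1 ≤ d → d ≤ s - 1 → istar ≠ i d) →
      superChar (Pm n m) θ lam 1 =
        (Fintype.card F : ℂ) ^ ((l s).val - m) *
          ∏ d ∈ Finset.Icc 1 (s - 1),
            (Fintype.card F : ℂ) ^ ((l d).val - (i d).val - 1)) := by
  have hs : 1 ≤ s := by
    obtain ⟨p, hp⟩ := hne
    obtain ⟨d, h1, h2, -⟩ := (hlset p.2).1 ⟨p.1, hp⟩
    omega
  have hl_lt : ∀ d, 1 ≤ d → d < s → l d < l s := fun d hd hds =>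
    lt_of_step_lt (f := fun d => (l d).val) (b := s) hlmono hd hds le_rfl
  have hl_inj : ∀ d d', 1 ≤ d → d < s → 1 ≤ d' → d' < s → l d = l d' → d = d' := by
    intro d d' hd hds hd' hds' h
    rcases lt_trichotomy d d' with hlt | heq | hlt
    · exact absurd (congrArg Fin.val h)
        (lt_of_step_lt (f := fun d => (l d).val) (b := s) hlmono hd hlt hds'.le).ne
    · exact heq
    · exact absurd (congrArg Fin.val h)
        (lt_of_step_lt (f := fun d => (l d).val) (b := s) hlmono hd' hlt hds.le).ne'
  have hcol : ∀ a c, lam a c ≠ 0 → ∃ d, 1 ≤ d ∧ d ≤ s ∧ c = l d :=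
    fun a c h => (hlset c).1 ⟨a, h⟩
  have hL : ∀ a c, lam a c ≠ 0 → c ≤ l s := by
    intro a c h
    obtain ⟨d, h1, h2, rfl⟩ := hcol a c h
    rcases eq_or_lt_of_le h2 with rfl | h3
    · exact le_rfl
    · exact (hl_lt d h1 h3).le
  have hi' : ∀ d, 1 ≤ d → d < s →
      lam (i d) (l d) ≠ 0 ∧ ∀ i' : Fin n, lam i' (l d) ≠ 0 → i' = i d :=
    fun d h1 h2 => hi d h1 (by omega)
  have hshape := isCombShape_of_connected hm hmn hcomb histar.1 histar.2 hL hconn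
  have hoff : ∀ a c, lam a c ≠ 0 → c ≠ l s → ∃ d, 1 ≤ d ∧ d < s ∧ a = i d ∧ c = l d := by
    intro a c h hc
    obtain ⟨d, h1, h2, rfl⟩ := hcol a c h
    have h3 : d < s := lt_of_le_of_ne h2 fun h => hc (by rw [h])
    exact ⟨d, h1, h3, (hi' d h1 h3).2 a h, rfl⟩
  have hi_pos : ∀ d, 1 ≤ d → d < s → 1 ≤ (i d).val := fun d h1 h2 =>
    hshape.row_pos _ _ (hi' d h1 h2).1 (hl_lt d h1 h2).ne
  have hm_le : ∀ d, 1 ≤ d → d < s → m ≤ (l d).val := fun d h1 h2 =>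
    hshape.le_col _ _ (hi' d h1 h2).1 (hl_lt d h1 h2).ne
  have hinj : ∀ d d', 1 ≤ d → d < s → 1 ≤ d' → d' < s → i d = i d' → d = d' := by
    intro d d' hd hds hd' hds' h
    refine hl_inj d d' hd hds hd' hds' (hshape.col_unique (i d) _ _ (hi' d hd hds).1 ?_
      (hl_lt d hd hds).ne (hl_lt d' hd' hds').ne)
    rw [h]
    exact (hi' d' hd' hds').1
  have hprod : ∏ d ∈ Finset.Icc 1 (s - 1),
        Fintype.card F ^ (Finset.univ.filter fun j => Pm n m (i d) j ∧ j < l d).card =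
      ∏ d ∈ Finset.Icc 1 (s - 1), Fintype.card F ^ ((l d).val - (i d).val - 1) := by
    refine Finset.prod_congr rfl fun d hd => ?_
    rw [Finset.mem_Icc] at hd
    rw [card_filter_Pm_of_pos _ _ (hi_pos d hd.1 (by omega))]
  rw [superChar_one]
  constructor
  · rintro ⟨hpos, hni⟩
    have key := ncard_dualLeftOrbit_of_pivots (m := m) (p := istar) hs hl_lt hcol hi' hinj histar.1
      ?_ (fun d h1 h2 => hni d h1 (by omega)) ?_
    · rw [key, hprod, card_filter_Pm_of_pos _ _ hpos]
      push_cast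
      rfl
    · intro c h
      by_contra hc
      obtain ⟨d, h1, h2, h3, -⟩ := hoff _ _ h hc
      exact hni d h1 (by omega) h3
    · intro a j ha haj
      by_cases has : a = istar
      · exact Or.inl (has ▸ haj)
      have hlt := hshape.row_lt a _ ha has
      have hbig : m ≤ j.val → Pm n m istar j := fun h =>
        ⟨Fin.lt_def.2 (by omega), fun h0 => by omega⟩
      by_cases ha0 : a.val = 0
      · have := haj.2 ha0
        exact Or.inl (hbig (by omega))
      obtain ⟨c, hc, hac⟩ := hshape.exists_col a ha ha0 has
      obtain ⟨d, h1, h2, h3, rfl⟩ := hoff _ _ hac hc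
      by_cases hj : j < l d
      · exact Or.inr ⟨d, h1, h2, h3, hj⟩
      · exact Or.inl (hbig ((hm_le d h1 h2).trans (not_lt.1 hj)))
  · intro hcase
    have hstar : istar.val ≠ 0 → ∃ c, c ≠ l s ∧ lam istar c ≠ 0 := by
      intro h0
      by_contra hno
      refine hcase ⟨by omega, fun d h1 h2 h => hno ⟨l d, (hl_lt d h1 (by omega)).ne, ?_⟩⟩
      rw [h]
      exact (hi d h1 h2).1
    let z : Fin n := ⟨0, by omega⟩
    have key := ncard_dualLeftOrbit_of_pivots (m := m) (p := z) hs hl_lt hcol hi' hinj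
      ?_ ?_ ?_ ?_
    · rw [key, hprod, card_filter_Pm_zero hm hmn z _ rfl]
      push_cast
      rfl
    · by_cases h0 : istar.val = 0
      · have : z = istar := Fin.ext h0.symm
        rw [this]
        exact histar.1
      · obtain ⟨c, hc, h⟩ := hstar h0
        exact hshape.zero_row c hc h z rfl
    · intro c h
      by_contra hc
      exact absurd (hshape.row_pos z c h hc) (by simp [z])
    · intro d h1 h2 h
      have := hi_pos d h1 h2
      rw [← h] at this
      simp [z] at this
    · intro a j ha haj
      by_cases ha0 : a.val = 0
      · have : z = a := Fin.ext ha0.symm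
        exact Or.inl (this ▸ haj)
      have hex : ∃ c, c ≠ l s ∧ lam a c ≠ 0 := by
        by_cases has : a = istar
        · subst has
          exact hstar ha0
        · exact hshape.exists_col a ha ha0 has
      obtain ⟨c, hc, hac⟩ := hex
      obtain ⟨d, h1, h2, h3, rfl⟩ := hoff _ _ hac hc
      by_cases hj : j < l d
      · exact Or.inr ⟨d, h1, h2, h3, hj⟩
      · have hmj : m ≤ j.val := (hm_le d h1 h2).trans (not_lt.1 hj)
        exact Or.inl ⟨Fin.lt_def.2 (by simp only [z]; omega), fun _ => by omega⟩
end

section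
/- Let λ ∈ 𝒮_n(q) and identify U_{n−1} with the subgroup U_{(n)} = {u ∈ U_n : u_{1j} = 0 for all j ≥ 2} of U_n. If λ_{1k} ≠ 0 for some k, write λ ∗_1 {k} = Σ_μ c_μ μ; then every matrix μ occurring in this sum has zero first row, and the restriction of the U_n-supercharacter χ^λ to U_{(n)} equals Σ_μ c_μ χ^μ, where χ^μ is the supercharacter of the group U_{(n)} attached to (the restriction of) μ. If λ_{1j} = 0 for all j, then the restriction of χ^λ to U_{(n)} is the supercharacter of U_{(n)} attached to λ. -/
open Matrix BigOperators
open scoped Classical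

section Star

variable {n : ℕ} {F : Type*} [Field F] [Fintype F]

/-- The matrix obtained from `A` by replacing the `(i,j)` entry by `t`. -/
def updEnt (A : Mat n F) (i j : Fin n) (t : F) : Mat n F :=
  Matrix.of fun p q => if p = i ∧ q = j then t else A p q

/-- The formal nonnegative-integer linear combination `λ ∗_i {k}` of strictly upper-triangular
matrices (0-based indices `i`, `k`), defined recursively:
`λ ∗_i {k} = λ` if `i = k`; otherwise `q·(λ ∗_{i+1} {k})` if `λ_{il} ≠ 0` for some `l > k`;
`(λ with (i,k) set to 0) ∗_{i+1} {k}` if `λ_{ik} ≠ 0`;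
`λ ∗_{i+1} {k} + Σ_{t≠0} (λ with (i,j) set to 0 and (i,k) set to t) ∗_{i+1} {j}` if
`λ_{ij} ≠ 0` for some `i < j < k`; and
`λ ∗_{i+1} {k} + Σ_{t≠0} (λ with (i,k) set to t)` if `λ_{ij} = 0` for all `j > i`. -/
noncomputable def starProd (lam : Mat n F) (i k : ℕ) : (Mat n F) →₀ ℕ :=
  if i = k then Finsupp.single lam 1
  else if h : i < k ∧ k < n then
    let iF : Fin n := ⟨i, lt_trans h.1 h.2⟩
    let kF : Fin n := ⟨k, h.2⟩
    if ∃ l : Fin n, k < l.val ∧ lam iF l ≠ 0 then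
      Fintype.card F • starProd lam (i + 1) k
    else if lam iF kF ≠ 0 then
      starProd (updEnt lam iF kF 0) (i + 1) k
    else if hj : ∃ j : Fin n, i < j.val ∧ j.val < k ∧ lam iF j ≠ 0 then
      starProd lam (i + 1) k +
        ∑ t ∈ Finset.univ \ {(0 : F)},
          starProd (updEnt (updEnt lam iF (Classical.choose hj) 0) iF kF t) (i + 1)
            (Classical.choose hj).val
    else
      starProd lam (i + 1) k +
        ∑ t ∈ Finset.univ \ {(0 : F)}, Finsupp.single (updEnt lam iF kF t) 1
  else 0
termination_by k - i
decreasing_by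
  all_goals (try have := Classical.choose_spec hj); omega

end Star

section Aux

set_option linter.unusedSectionVars false

/-- The pattern `i < j` restricted to the rows of index at least `m`. -/
def rowPat (n m : ℕ) : Fin n → Fin n → Prop := fun i j => i < j ∧ m ≤ i.val

lemma Plt_eq_rowPat (n : ℕ) : Plt n = rowPat n 0 := by
  funext i j
  simp [Plt, rowPat]

lemma Pm_eq_rowPat (n : ℕ) : Pm n n = rowPat n 1 := by
  funext i j
  simp only [Pm, rowPat, eq_iff_iff]
  have := j.isLt
  constructor
  · rintro ⟨h, h'⟩
    exact ⟨h, by by_contra hc; have := h' (by omega); omega⟩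
  · rintro ⟨h, h'⟩
    exact ⟨h, fun h0 => by omega⟩

/-- If a map from a finite group has fibres compatible with left multiplication, its fibres all have the same size, so
summing over the group is the same as summing over the range up to a constant. -/
lemma ncard_range_mul_sum {G X : Type*} [Group G] [Fintype G] (Φ : G → X)
    (hΦ : ∀ k g h, Φ g = Φ h → Φ (k * g) = Φ (k * h)) (f : X → ℂ) :
    ((Set.range Φ).ncard : ℂ) * ∑ g, f (Φ g) = (Fintype.card G : ℂ) * ∑ᶠ y ∈ Set.range Φ, f y := by
  have hR : Set.range Φ = ↑(Finset.univ.image Φ) := by simp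
  have hfib : ∀ y ∈ Finset.univ.image Φ, (Finset.univ.filter fun g => Φ g = y).card =
      (Finset.univ.filter fun g => Φ g = Φ 1).card := by
    intro y hy
    obtain ⟨g, -, rfl⟩ := Finset.mem_image.1 hy
    refine Finset.card_bij' (fun h _ => g⁻¹ * h) (fun h _ => g * h) ?_ ?_ ?_ ?_
    · intro h hh
      simp only [Finset.mem_filter, Finset.mem_univ, true_and] at hh ⊢
      simpa using hΦ g⁻¹ _ _ hh
    · intro h hh
      simp only [Finset.mem_filter, Finset.mem_univ, true_and] at hh ⊢
      simpa using hΦ g _ _ hh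
    · simp
    · simp
  rw [hR, Set.ncard_coe_finset, finsum_mem_coe_finset, Finset.sum_comp f Φ, ← Finset.card_univ,
    Finset.card_eq_sum_card_image Φ Finset.univ, Finset.sum_congr rfl hfib, Finset.sum_const,
    Finset.sum_congr rfl (fun y hy => by rw [hfib y hy]), ← Finset.smul_sum]
  simp only [nsmul_eq_mul, smul_eq_mul, Nat.cast_mul]
  ring

variable {n : ℕ} {F : Type*} [Field F]

/-- Matrices supported on `rowPat n m`. -/
def nilSub (n m : ℕ) (F : Type*) [Field F] : Submodule F (Mat n F) where
  carrier := {x | ∀ i j, ¬ rowPat n m i j → x i j = 0}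
  add_mem' := by
    intro a b ha hb i j h
    simp [ha i j h, hb i j h]
  zero_mem' := by simp
  smul_mem' := by
    intro c a ha i j h
    simp [ha i j h]

lemma mem_nilSub {m : ℕ} {x : Mat n F} :
    x ∈ nilSub n m F ↔ ∀ i j, ¬ rowPat n m i j → x i j = 0 := Iff.rfl

lemma mem_patGroup_iff {m : ℕ} {u : Mat n F} :
    u ∈ patGroup (rowPat n m) ↔ u - 1 ∈ nilSub n m F := by
  simp only [patGroup, Set.mem_ofPred_eq, mem_nilSub, Matrix.sub_apply]
  constructor
  · rintro ⟨h1, h2⟩ i j h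
    by_cases hij : i = j
    · subst hij; simp [h1]
    · simp [h2 i j hij h, Matrix.one_apply_ne hij]
  · intro h
    refine ⟨fun i => ?_, fun i j hij hP => ?_⟩
    · have := h i i (by simp [rowPat])
      simpa [sub_eq_zero] using this
    · simpa [Matrix.one_apply_ne hij] using h i j hP

lemma nilSub_mul {m : ℕ} {x y : Mat n F} (hx : x ∈ nilSub n m F) (hy : y ∈ nilSub n m F) :
    x * y ∈ nilSub n m F := by
  intro i j h
  rw [Matrix.mul_apply]
  refine Finset.sum_eq_zero fun k _ => ?_
  by_cases h1 : rowPat n m i k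
  · by_cases h2 : rowPat n m k j
    · exact absurd ⟨h1.1.trans h2.1, h1.2⟩ h
    · rw [hy k j h2, mul_zero]
  · rw [hx i k h1, zero_mul]

lemma patGroup_mul_nilSub {m : ℕ} {a x : Mat n F} (ha : a ∈ patGroup (rowPat n m))
    (hx : x ∈ nilSub n m F) : a * x ∈ nilSub n m F := by
  have : a * x = (a - 1) * x + x := by noncomm_ring
  rw [this]
  exact add_mem (nilSub_mul (mem_patGroup_iff.1 ha) hx) hx

lemma nilSub_mul_patGroup {m : ℕ} {a x : Mat n F} (ha : a ∈ patGroup (rowPat n m))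
    (hx : x ∈ nilSub n m F) : x * a ∈ nilSub n m F := by
  have : x * a = x * (a - 1) + x := by noncomm_ring
  rw [this]
  exact add_mem (nilSub_mul hx (mem_patGroup_iff.1 ha)) hx

lemma pairM_add (A B C : Mat n F) : pairM A (B + C) = pairM A B + pairM A C := by
  simp [pairM, mul_add, Finset.sum_add_distrib]

lemma pairM_smul (A B : Mat n F) (c : F) : pairM A (c • B) = c * pairM A B := by
  simp [pairM, Finset.mul_sum, mul_left_comm]

lemma pairM_eq_trace (A B : Mat n F) : pairM A B = (Aᵀ * B).trace := by
  simp only [pairM, Matrix.trace, Matrix.diag, Matrix.mul_apply, Matrix.transpose_apply]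
  exact Finset.sum_comm

lemma pairM_mul_mul (A B C x : Mat n F) :
    pairM (Aᵀ * B * Cᵀ) x = pairM B (A * x * C) := by
  rw [pairM_eq_trace, pairM_eq_trace, Matrix.transpose_mul, Matrix.transpose_mul,
    Matrix.transpose_transpose, Matrix.transpose_transpose, Matrix.mul_assoc, Matrix.trace_mul_comm]
  simp only [Matrix.mul_assoc]

lemma pairM_truncP {m : ℕ} (A x : Mat n F) (hx : x ∈ nilSub n m F) :
    pairM (truncP (rowPat n m) A) x = pairM A x := by
  refine Finset.sum_congr rfl fun i _ => Finset.sum_congr rfl fun j _ => ?_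
  by_cases h : rowPat n m i j
  · simp [truncP, h]
  · simp [hx i j h]

lemma pairM_single (A : Mat n F) (i j : Fin n) (c : F) :
    pairM A (Matrix.single i j c) = A i j * c := by
  rw [pairM, Finset.sum_eq_single i, Finset.sum_eq_single j]
  · simp
  · intro b _ hb; simp [Matrix.single_apply_of_ne, hb.symm]
  · simp
  · intro b _ hb
    refine Finset.sum_eq_zero fun j _ => ?_
    simp [Matrix.single_apply_of_ne, hb.symm]
  · simp

lemma single_mem_nilSub {m : ℕ} {i j : Fin n} (h : rowPat n m i j) (c : F) :
    Matrix.single i j c ∈ nilSub n m F := by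
  intro i' j' h'
  rw [Matrix.single_apply_of_ne]
  rintro ⟨rfl, rfl⟩
  exact h' h

lemma truncP_eq_iff {m : ℕ} (A B : Mat n F) :
    truncP (rowPat n m) A = truncP (rowPat n m) B ↔
      ∀ x ∈ nilSub n m F, pairM A x = pairM B x := by
  constructor
  · intro h x hx
    rw [← pairM_truncP A x hx, h, pairM_truncP B x hx]
  · intro h
    ext i j
    by_cases hP : rowPat n m i j
    · have := h _ (single_mem_nilSub hP 1)
      simpa [pairM_single, truncP, hP] using this
    · simp [truncP, hP]

lemma isUnit_of_mem_patGroup {m : ℕ} {a : Mat n F} (ha : a ∈ patGroup (rowPat n m)) :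
    IsUnit a := by
  rw [Matrix.isUnit_iff_isUnit_det, Matrix.det_of_isUpperTriangular]
  · simp [ha.1]
  · intro i j hij
    exact ha.2 i j (ne_of_gt hij) fun h => absurd h.1 (not_lt_of_gt hij)

/-- The pattern group of `rowPat n m` as a subgroup of the units. -/
noncomputable def patSubgroup (n m : ℕ) (F : Type*) [Field F] [Fintype F] :
    Subgroup (Mat n F)ˣ :=
  { carrier := {u | (u : Mat n F) ∈ patGroup (rowPat n m)}
    mul_mem' := by
      intro a b ha hb
      simp only [Set.mem_ofPred_eq, Units.val_mul] at *
      have : (a * b : Mat n F) - 1 = a * (b - 1) + (a - 1) := by noncomm_ring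
      rw [mem_patGroup_iff, this]
      exact add_mem (patGroup_mul_nilSub ha (mem_patGroup_iff.1 hb)) (mem_patGroup_iff.1 ha)
    one_mem' := by simp [mem_patGroup_iff]
    inv_mem' := by
      intro a ha
      have hpow : ∀ k : ℕ, ((a ^ k : (Mat n F)ˣ) : Mat n F) ∈ patGroup (rowPat n m) := by
        intro k
        induction k with
        | zero => simp [mem_patGroup_iff]
        | succ k ih =>
          have : ((a ^ (k + 1) : (Mat n F)ˣ) : Mat n F) - 1
              = ((a ^ k : (Mat n F)ˣ) : Mat n F) * (a - 1)
                + (((a ^ k : (Mat n F)ˣ) : Mat n F) - 1) := by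
            rw [pow_succ, Units.val_mul]; noncomm_ring
          rw [mem_patGroup_iff, this]
          exact add_mem (patGroup_mul_nilSub ih (mem_patGroup_iff.1 ha)) (mem_patGroup_iff.1 ih)
      have hmem : a⁻¹ ∈ Submonoid.powers a := by
        rw [mem_powers_iff_mem_zpowers]
        exact inv_mem (Subgroup.mem_zpowers a)
      obtain ⟨k, hk⟩ := hmem
      have := hpow k
      rwa [show a ^ k = a⁻¹ from hk] at this }

variable [Fintype F]

lemma mem_patSubgroup {m : ℕ} {u : (Mat n F)ˣ} :
    u ∈ patSubgroup n m F ↔ (u : Mat n F) ∈ patGroup (rowPat n m) := Iff.rfl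

/-- The bijection `u ↦ u - 1` from the pattern group to its nilpotent algebra. -/
noncomputable def patEquivNil (n m : ℕ) (F : Type*) [Field F] [Fintype F] :
    patSubgroup n m F ≃ nilSub n m F :=
  Equiv.ofBijective (fun u => ⟨((u : (Mat n F)ˣ) : Mat n F) - 1, mem_patGroup_iff.1 u.2⟩) (by
    constructor
    · intro u v h
      have := congrArg Subtype.val h
      exact Subtype.ext (Units.ext (by simpa using this))
    · intro y
      have hy : (y : Mat n F) + 1 ∈ patGroup (rowPat n m) := by
        rw [mem_patGroup_iff]; simp
      refine ⟨⟨(isUnit_of_mem_patGroup hy).unit, ?_⟩, ?_⟩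
      · rw [mem_patSubgroup]; simpa using hy
      · ext; simp)

lemma coe_patEquivNil {m : ℕ} (u : patSubgroup n m F) :
    (patEquivNil n m F u : Mat n F) = ((u : (Mat n F)ˣ) : Mat n F) - 1 := rfl

lemma sum_patSubgroup_pairM {m : ℕ} (θ : AddChar F ℂ) (hθ : ∃ x, θ x ≠ 1) (lam z : Mat n F) :
    ∑ b : patSubgroup n m F, θ (-pairM lam (z * ((b : (Mat n F)ˣ) : Mat n F))) =
      (Fintype.card (patSubgroup n m F) : ℂ) *
        if ∀ y ∈ nilSub n m F, pairM lam (z * y) = 0 then θ (-pairM lam z) else 0 := by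
  let ψ : AddChar (nilSub n m F) ℂ := θ.compAddMonoidHom
    (AddMonoidHom.mk' (fun y : nilSub n m F => -pairM lam (z * (y : Mat n F))) (by
      intro a b
      simp only [Submodule.coe_add, mul_add, pairM_add]
      ring))
  have hsum : ∑ b : patSubgroup n m F, θ (-pairM lam (z * ((b : (Mat n F)ˣ) : Mat n F))) =
      θ (-pairM lam z) * ∑ y, ψ y := by
    rw [← Equiv.sum_comp (patEquivNil n m F) ψ, Finset.mul_sum]
    refine Finset.sum_congr rfl fun b _ => ?_
    change _ = _ * θ (-pairM lam (z * (patEquivNil n m F b : Mat n F)))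
    rw [← AddChar.map_add_eq_mul, ← neg_add, ← pairM_add, coe_patEquivNil, mul_sub, mul_one,
      add_sub_cancel]
  rw [hsum, AddChar.sum_eq_ite, Fintype.card_congr (patEquivNil n m F)]
  have hiff : ψ = 0 ↔ ∀ y ∈ nilSub n m F, pairM lam (z * y) = 0 := by
    constructor
    · intro h y hy
      by_contra hc
      obtain ⟨t, ht⟩ := hθ
      apply ht
      have := DFunLike.congr_fun h ⟨(-(t / pairM lam (z * y))) • y, Submodule.smul_mem _ _ hy⟩
      change θ (-pairM lam (z * ((-(t / pairM lam (z * y))) • y))) = 1 at this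
      rw [Matrix.mul_smul, pairM_smul] at this
      rwa [show -(-(t / pairM lam (z * y)) * pairM lam (z * y)) = t by field_simp] at this
    · intro h
      ext y
      change θ (-pairM lam (z * (y : Mat n F))) = 1
      rw [h y y.2]; simp
  by_cases h : ∀ y ∈ nilSub n m F, pairM lam (z * y) = 0
  · rw [if_pos (hiff.2 h), if_pos h, mul_comm]
  · rw [if_neg (fun h' => h (hiff.1 h')), if_neg h]; simp

/-- The supercharacter as a sum over the left orbit. -/
lemma superChar_eq_sum_left {m : ℕ} (θ : AddChar F ℂ) (hθ : ∃ x, θ x ≠ 1) (lam u : Mat n F)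
    (hu : u ∈ patGroup (rowPat n m)) :
    superChar (rowPat n m) θ lam u =
      ∑ᶠ mu ∈ dualLeftOrbit (rowPat n m) lam,
        if ∀ y ∈ nilSub n m F, pairM mu ((u - 1) * y) = 0 then θ (-pairM mu (u - 1)) else 0 := by
  set x := u - 1 with hx_def
  have hx : x ∈ nilSub n m F := mem_patGroup_iff.1 hu
  let H := patSubgroup n m F
  let c : H → Mat n F := fun a => ((a : (Mat n F)ˣ) : Mat n F)
  have hc : ∀ a, c a ∈ patGroup (rowPat n m) := fun a => a.2
  have hci : ∀ a, c a⁻¹ = (c a)⁻¹ := fun a => by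
    simp [c, Matrix.coe_units_inv]
  have hcm : ∀ a b, c (a * b) = c a * c b := fun a b => by simp [c]
  have hsurj : ∀ a ∈ (patGroup (rowPat n m) : Set (Mat n F)), ∃ b : H, c b = a := fun a ha =>
    ⟨⟨(isUnit_of_mem_patGroup ha).unit, by rw [mem_patSubgroup]; simpa using ha⟩, by simp [c]⟩
  let Φ : H × H → Mat n F := fun p => truncP (rowPat n m) ((c p.1⁻¹)ᵀ * lam * (c p.2)ᵀ)
  let Ψ : H → Mat n F := fun a => truncP (rowPat n m) ((c a⁻¹)ᵀ * lam)
  have hΦ : Set.range Φ = dualOrbit (rowPat n m) lam := by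
    ext mu
    constructor
    · rintro ⟨p, rfl⟩
      refine ⟨c p.1, hc _, c p.2⁻¹, hc _, ?_⟩
      rw [← hci, ← hci, inv_inv]
    · rintro ⟨a, ha, b, hb, rfl⟩
      obtain ⟨a, rfl⟩ := hsurj a ha
      obtain ⟨b, rfl⟩ := hsurj b hb
      exact ⟨(a, b⁻¹), by simp only [Φ, hci]⟩
  have hΨ : Set.range Ψ = dualLeftOrbit (rowPat n m) lam := by
    ext mu
    constructor
    · rintro ⟨p, rfl⟩
      refine ⟨c p, hc _, ?_⟩
      rw [← hci]
    · rintro ⟨a, ha, rfl⟩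
      obtain ⟨a, rfl⟩ := hsurj a ha
      exact ⟨a, by simp only [Ψ, hci]⟩
  have hΨpair : ∀ a, ∀ z, pairM ((c a⁻¹)ᵀ * lam) z = pairM lam (c a⁻¹ * z) := fun a z => by
    have := pairM_mul_mul (c a⁻¹) lam 1 z
    simpa using this
  have hΦeq : ∀ k g h, Φ g = Φ h → Φ (k * g) = Φ (k * h) := by
    intro k g h hgh
    simp only [Φ, truncP_eq_iff, pairM_mul_mul] at hgh ⊢
    intro z hz
    have := hgh (c k.1⁻¹ * z * c k.2) (nilSub_mul_patGroup (hc _) (patGroup_mul_nilSub (hc _) hz))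
    simpa only [Prod.fst_mul, Prod.snd_mul, _root_.mul_inv_rev, hcm, mul_assoc] using this
  have hΨeq : ∀ k g h, Ψ g = Ψ h → Ψ (k * g) = Ψ (k * h) := by
    intro k g h hgh
    simp only [Ψ, truncP_eq_iff, hΨpair] at hgh ⊢
    intro z hz
    have := hgh (c k⁻¹ * z) (patGroup_mul_nilSub (hc _) hz)
    simpa only [_root_.mul_inv_rev, hcm, mul_assoc] using this
  let g : Mat n F → ℂ := fun mu =>
    if ∀ y ∈ nilSub n m F, pairM mu (x * y) = 0 then θ (-pairM mu x) else 0
  have h1 := ncard_range_mul_sum Φ hΦeq fun mu => θ (-pairM mu x)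
  have h2 := ncard_range_mul_sum Ψ hΨeq g
  have h3 : ∑ p, θ (-pairM (Φ p) x) = (Fintype.card H : ℂ) * ∑ a, g (Ψ a) := by
    rw [Fintype.sum_prod_type, Finset.mul_sum]
    refine Finset.sum_congr rfl fun a _ => ?_
    have := sum_patSubgroup_pairM (m := m) θ hθ lam (c a⁻¹ * x)
    simp only [Φ, pairM_truncP _ _ hx, pairM_mul_mul]
    refine this.trans ?_
    congr 1
    simp only [g, Ψ, pairM_truncP _ _ hx, hΨpair]
    refine if_congr (forall₂_congr fun y hy => ?_) rfl rfl
    rw [pairM_truncP _ _ (nilSub_mul hx hy), hΨpair, mul_assoc]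
  have hH : (Fintype.card H : ℂ) ≠ 0 := by exact_mod_cast Fintype.card_ne_zero
  have hO : ((Set.range Φ).ncard : ℂ) ≠ 0 := by
    have : (Set.range Φ).ncard ≠ 0 :=
      (Set.ncard_pos (Set.finite_range Φ)).2 (Set.range_nonempty Φ) |>.ne'
    exact_mod_cast this
  unfold superChar
  change _ = ∑ᶠ mu ∈ dualLeftOrbit (rowPat n m) lam, g mu
  rw [← hΦ, ← hΨ]
  rw [h3, Fintype.card_prod, Nat.cast_mul, mul_assoc] at h1
  have h1' := mul_left_cancel₀ hH ((mul_left_comm _ _ _).symm.trans h1)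
  rw [div_mul_eq_mul_div, div_eq_iff hO]
  apply mul_left_cancel₀ hH
  rw [mul_left_comm, ← h1', ← mul_assoc, mul_comm _ ((Set.range Φ).ncard : ℂ), mul_assoc, h2]
  ring
lemma addChar_map_sum {ι : Type*} (θ : AddChar F ℂ) (s : Finset ι) (f : ι → F) :
    θ (∑ i ∈ s, f i) = ∏ i ∈ s, θ (f i) := by
  induction s using Finset.induction_on with
  | empty => simp
  | insert a s ha ih => rw [Finset.sum_insert ha, Finset.prod_insert ha, AddChar.map_add_eq_mul, ih]

/-- The contribution of a column vector `v`, placed in column `j`, to a supercharacter value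
at `1 + x`. -/
noncomputable def colWeight (θ : AddChar F ℂ) (x : Mat n F) (j : Fin n) (v : Fin n → F) : ℂ :=
  if ∀ l < j, (v ᵥ* x) l = 0 then θ (-(v ᵥ* x) j) else 0

/-- The possible `j`-th columns of elements of the left orbit of a matrix with `j`-th column
`c`, where `c` has at most one nonzero entry. -/
noncomputable def colSet (j : Fin n) (c : Fin n → F) : Finset (Fin n → F) :=
  Finset.univ.filter fun v => ∀ r, (j ≤ r ∨ ∀ s < r, c s = 0) → v r = c r

/-- The factor contributed by column `j` to a supercharacter value at `1 + x`. -/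
noncomputable def colSum (θ : AddChar F ℂ) (x : Mat n F) (j : Fin n) (c : Fin n → F) : ℂ :=
  ∑ v ∈ colSet j c, colWeight θ x j v

lemma mem_dualLeftOrbit_iff {m : ℕ} {lam mu : Mat n F} (hlam : lam ∈ Sset n F)
    (hm : ∀ i j : Fin n, i.val < m → lam i j = 0) :
    mu ∈ dualLeftOrbit (rowPat n m) lam ↔ ∀ j, (fun i => mu i j) ∈ colSet j fun i => lam i j := by
  obtain ⟨hup, hrow, hcol⟩ := hlam
  simp only [colSet, Finset.mem_filter, Finset.mem_univ, true_and]
  have hinv : ∀ a ∈ (patGroup (rowPat n m) : Set (Mat n F)),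
      a⁻¹ ∈ (patGroup (rowPat n m) : Set (Mat n F)) ∧ a⁻¹⁻¹ = a := by
    intro a ha
    have hu := isUnit_of_mem_patGroup ha
    refine ⟨?_, Matrix.nonsing_inv_nonsing_inv _ ((Matrix.isUnit_iff_isUnit_det _).1 hu)⟩
    have : hu.unit ∈ patSubgroup n m F := by rw [mem_patSubgroup]; simpa using ha
    have := inv_mem this
    rw [mem_patSubgroup, Matrix.coe_units_inv] at this
    simpa using this
  constructor
  · rintro ⟨a, ha, rfl⟩ j r hr
    have ha' := (hinv a ha).1
    simp only [truncP, Matrix.of_apply]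
    split_ifs with hP
    · have hr' := hr.resolve_left (not_le_of_gt hP.1)
      rw [Matrix.mul_apply, Finset.sum_eq_single r]
      · simp [ha'.1]
      · intro s _ hsr
        rcases lt_or_gt_of_ne hsr with h | h
        · simp [hr' s h]
        · rw [Matrix.transpose_apply, ha'.2 s r hsr fun hP => absurd hP.1 (not_lt_of_gt h),
            zero_mul]
      · simp
    · by_cases h : r < j
      · exact (hm r j (by by_contra hc; exact hP ⟨h, by omega⟩)).symm
      · exact (hup r j h).symm
  · intro h
    let a : Mat n F := Matrix.of fun s r =>
      if s = r then 1 else if s < r then ∑ j, (lam s j)⁻¹ * mu r j else 0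
    have ha : a ∈ patGroup (rowPat n m) := by
      refine ⟨fun i => by simp [a], fun s r hsr hP => ?_⟩
      simp only [a, Matrix.of_apply, if_neg hsr]
      split_ifs with hlt
      · refine Finset.sum_eq_zero fun j _ => ?_
        rw [hm s j (by by_contra hc; exact hP ⟨hlt, by omega⟩)]
        simp
      · rfl
    refine ⟨a⁻¹, (hinv a ha).1, ?_⟩
    rw [(hinv a ha).2]
    ext r j
    simp only [truncP, Matrix.of_apply]
    split_ifs with hP
    · rw [Matrix.mul_apply]
      by_cases hz : ∀ s, lam s j = 0
      · rw [h j r (Or.inr fun s _ => hz s), hz r, Finset.sum_eq_zero]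
        intro s _; simp [hz s]
      · push Not at hz
        obtain ⟨i, hi⟩ := hz
        have hother : ∀ s, s ≠ i → lam s j = 0 := fun s hs => by
          by_contra hc; exact hs (hcol _ _ _ hc hi)
        rw [Finset.sum_eq_single i]
        · rw [Matrix.transpose_apply]
          simp only [a, Matrix.of_apply]
          split_ifs with h1 h2
          · subst h1
            rw [one_mul]
            exact h j _ (Or.inr fun s hs => hother s hs.ne)
          · rw [Finset.sum_eq_single j]
            · field_simp
            · intro j' _ hj'
              have : lam i j' = 0 := by by_contra hc; exact hj' (hrow _ _ _ hc hi)
              simp [this]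
            · simp
          · have hri : r < i := lt_of_le_of_ne (not_lt.1 h2) (Ne.symm h1)
            rw [h j r (Or.inr fun s hs => hother s (hs.trans hri).ne), hother r hri.ne]
            simp
        · intro s _ hs
          rw [hother s hs, mul_zero]
        · simp
    · by_cases hrj : r < j
      · have hrm : r.val < m := by by_contra hc; exact hP ⟨hrj, by omega⟩
        rw [h j r (Or.inr fun s hs => hm s j (lt_trans hs hrm)), hm r j hrm]
      · rw [h j r (Or.inl (not_lt.1 hrj)), hup r j hrj]

/-- A supercharacter value factors over the columns of `lam`. -/
lemma superChar_eq_prod {m : ℕ} (θ : AddChar F ℂ) (hθ : ∃ x, θ x ≠ 1) {lam u : Mat n F}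
    (hu : u ∈ patGroup (rowPat n m)) (hlam : lam ∈ Sset n F)
    (hm : ∀ i j : Fin n, i.val < m → lam i j = 0) :
    superChar (rowPat n m) θ lam u = ∏ j, colSum θ (u - 1) j fun i => lam i j := by
  rw [superChar_eq_sum_left θ hθ lam u hu]
  set x := u - 1 with hx_def
  have hx : x ∈ nilSub n m F := mem_patGroup_iff.1 hu
  have hset : dualLeftOrbit (rowPat n m) lam = ↑(Finset.univ.filter fun mu : Mat n F =>
      ∀ j, (fun i => mu i j) ∈ colSet j fun i => lam i j) := by
    ext mu; simp [mem_dualLeftOrbit_iff hlam hm]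
  rw [hset, finsum_mem_coe_finset]
  unfold colSum
  rw [Finset.prod_univ_sum]
  refine Finset.sum_nbij' (fun mu j i => mu i j) (fun p => Matrix.of fun i j => p j i)
    ?_ ?_ ?_ ?_ ?_
  · intro mu hmu
    simpa [Fintype.mem_piFinset] using hmu
  · intro p hp
    simpa [Fintype.mem_piFinset] using hp
  · intro mu _; rfl
  · intro p _; rfl
  · intro mu _
    have hpair : ∀ z : Mat n F, pairM mu z = ∑ j, ∑ i, mu i j * z i j := fun z => Finset.sum_comm
    have hcond : (∀ y ∈ nilSub n m F, pairM mu (x * y) = 0) ↔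
        ∀ j, ∀ l < j, ((fun i => mu i j) ᵥ* x) l = 0 := by
      have hpm : ∀ y, pairM mu (x * y) = ∑ j, ∑ l, ((fun i => mu i j) ᵥ* x) l * y l j := by
        intro y
        rw [hpair]
        refine Finset.sum_congr rfl fun j _ => ?_
        simp only [Matrix.mul_apply, Matrix.vecMul, dotProduct, Finset.mul_sum, Finset.sum_mul]
        rw [Finset.sum_comm]
        simp only [mul_assoc]
      constructor
      · intro h j l hlj
        by_cases hl : m ≤ l.val
        · have := h _ (single_mem_nilSub (i := l) (j := j) ⟨hlj, hl⟩ 1)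
          rw [hpm, Finset.sum_eq_single j, Finset.sum_eq_single l] at this
          · simpa using this
          · intro b _ hb; simp [Matrix.single_apply_of_ne, hb.symm]
          · simp
          · intro b _ hb
            refine Finset.sum_eq_zero fun j _ => ?_
            simp [Matrix.single_apply_of_ne, hb.symm]
          · simp
        · simp only [Matrix.vecMul, dotProduct]
          refine Finset.sum_eq_zero fun i _ => ?_
          rw [hx i l, mul_zero]
          rintro ⟨h1, h2⟩
          exact hl (h2.trans (le_of_lt h1))
      · intro h y hy
        rw [hpm]
        refine Finset.sum_eq_zero fun j _ => Finset.sum_eq_zero fun l _ => ?_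
        by_cases hP : rowPat n m l j
        · rw [h j l hP.1, zero_mul]
        · rw [hy l j hP, mul_zero]
    unfold colWeight
    by_cases h : ∀ j, ∀ l < j, ((fun i => mu i j) ᵥ* x) l = 0
    · rw [if_pos (hcond.2 h), Finset.prod_congr rfl fun j _ => if_pos (h j),
        ← addChar_map_sum, Finset.sum_neg_distrib, hpair]
      rfl
    · rw [if_neg (fun h' => h (hcond.1 h'))]
      push Not at h
      obtain ⟨j, l, hl, hne⟩ := h
      rw [Finset.prod_eq_zero (Finset.mem_univ j)]
      exact if_neg fun h' => hne (h' l hl)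

/-- The sum of the weights of the vectors supported on `[i, k)`. -/
noncomputable def tailSum (θ : AddChar F ℂ) (x : Mat n F) (i : ℕ) (k : Fin n) : ℂ :=
  ∑ v with (∀ r : Fin n, r.val < i ∨ k ≤ r → v r = 0), colWeight θ x k v

/-- The sum of the weights of the vectors supported on `[i, k)` with `i`-th entry `t`. -/
noncomputable def leadSum (θ : AddChar F ℂ) (x : Mat n F) (i k : Fin n) (t : F) : ℂ :=
  ∑ v with ((∀ r : Fin n, r < i ∨ k ≤ r → v r = 0) ∧ v i = t), colWeight θ x k v

lemma colWeight_zero (θ : AddChar F ℂ) (x : Mat n F) (k : Fin n) : colWeight θ x k 0 = 1 := by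
  simp [colWeight]

lemma colSum_zero (θ : AddChar F ℂ) (x : Mat n F) (k : Fin n) : colSum θ x k 0 = 1 := by
  have : colSet k (0 : Fin n → F) = {0} := by
    ext v
    simp [colSet, funext_iff]
  rw [colSum, this, Finset.sum_singleton, colWeight_zero]

lemma tailSum_self (θ : AddChar F ℂ) (x : Mat n F) (k : Fin n) : tailSum θ x k.val k = 1 := by
  have : (Finset.univ.filter fun v : Fin n → F => ∀ r : Fin n, r.val < k.val ∨ k ≤ r → v r = 0)
      = {0} := by
    ext v
    simp only [Finset.mem_filter, Finset.mem_univ, true_and, Finset.mem_singleton, funext_iff]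
    exact ⟨fun h r => h r (lt_or_ge r k), fun h r _ => h r⟩
  rw [tailSum, this, Finset.sum_singleton, colWeight_zero]

lemma leadSum_zero (θ : AddChar F ℂ) (x : Mat n F) (i k : Fin n) :
    leadSum θ x i k 0 = tailSum θ x (i.val + 1) k := by
  unfold leadSum tailSum
  congr 1
  ext v
  simp only [Finset.mem_filter, Finset.mem_univ, true_and]
  constructor
  · rintro ⟨h, h'⟩ r hr
    by_cases hri : r = i
    · rw [hri, h']
    · exact h r (hr.imp_left fun hr => lt_of_le_of_ne (by simpa [Nat.lt_succ_iff] using hr) hri)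
  · intro h
    exact ⟨fun r hr => h r (hr.imp_left fun hr => Nat.lt_succ_of_lt hr),
      h i (Or.inl (Nat.lt_succ_self _))⟩

lemma tailSum_eq_sum_leadSum (θ : AddChar F ℂ) (x : Mat n F) (i k : Fin n) :
    tailSum θ x i.val k = ∑ t, leadSum θ x i k t := by
  unfold leadSum tailSum
  rw [← Finset.sum_fiberwise _ (fun v : Fin n → F => v i)]
  refine Finset.sum_congr rfl fun t _ => Finset.sum_congr ?_ fun _ _ => rfl
  ext v
  simp

lemma colSum_single (θ : AddChar F ℂ) (x : Mat n F) {i k : Fin n} (hik : i < k) {t : F}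
    (ht : t ≠ 0) : colSum θ x k (Pi.single i t) = leadSum θ x i k t := by
  unfold colSum leadSum
  congr 1
  ext v
  simp only [colSet, Finset.mem_filter, Finset.mem_univ, true_and]
  constructor
  · intro h
    constructor
    · rintro r (hr | hr)
      · rw [h r (Or.inr fun s hs => Pi.single_eq_of_ne (hs.trans hr).ne _),
          Pi.single_eq_of_ne hr.ne]
      · rw [h r (Or.inl hr), Pi.single_eq_of_ne (hik.trans_le hr).ne']
    · rw [h i (Or.inr fun s hs => Pi.single_eq_of_ne hs.ne _), Pi.single_eq_same]
  · rintro ⟨h, hi⟩ r hr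
    rcases lt_trichotomy r i with hri | rfl | hri
    · rw [h r (Or.inl hri), Pi.single_eq_of_ne hri.ne]
    · rw [hi, Pi.single_eq_same]
    · rcases hr with hr | hr
      · rw [h r (Or.inr hr), Pi.single_eq_of_ne hri.ne']
      · exact absurd (by simpa using hr i hri) ht

lemma tailSum_succ (θ : AddChar F ℂ) (x : Mat n F) {i k : Fin n} (hik : i < k) :
    tailSum θ x i.val k = tailSum θ x (i.val + 1) k +
      ∑ t ∈ Finset.univ \ {(0 : F)}, colSum θ x k (Pi.single i t) := by
  rw [tailSum_eq_sum_leadSum, ← leadSum_zero θ x i k,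
    ← Finset.sum_sdiff (Finset.subset_univ {(0 : F)}), Finset.sum_singleton, add_comm]
  congr 1
  refine Finset.sum_congr rfl fun t ht => (colSum_single θ x hik ?_).symm
  simpa using ht

lemma colWeight_add (θ : AddChar F ℂ) (x : Mat n F) (k : Fin n) (v w : Fin n → F)
    (hw : ∀ l ≤ k, (w ᵥ* x) l = 0) : colWeight θ x k (v + w) = colWeight θ x k v := by
  unfold colWeight
  rw [Matrix.add_vecMul, Pi.add_apply, hw k le_rfl, add_zero]
  refine if_congr (forall₂_congr fun l hl => ?_) rfl rfl
  rw [Pi.add_apply, hw l hl.le, add_zero]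

lemma leadSum_eq_of_vecMul (θ : AddChar F ℂ) (x : Mat n F) {i k : Fin n} {w : Fin n → F}
    (hsupp : ∀ r : Fin n, r < i ∨ k ≤ r → w r = 0) (hwi : w i ≠ 0)
    (hw : ∀ l ≤ k, (w ᵥ* x) l = 0) (s s' : F) : leadSum θ x i k s = leadSum θ x i k s' := by
  have hsmul : ∀ c : F, ∀ l ≤ k, ((c • w) ᵥ* x) l = 0 := fun c l hl => by
    rw [Matrix.smul_vecMul, Pi.smul_apply, hw l hl, smul_zero]
  refine Finset.sum_nbij' (fun v => v + ((s' - s) / w i) • w) (fun v => v + ((s - s') / w i) • w)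
    ?_ ?_ ?_ ?_ ?_
  · intro v hv
    simp only [Finset.mem_filter, Finset.mem_univ, true_and, Pi.add_apply, Pi.smul_apply,
      smul_eq_mul] at hv ⊢
    refine ⟨fun r hr => by rw [hv.1 r hr, hsupp r hr]; simp, ?_⟩
    rw [hv.2]; field_simp; ring
  · intro v hv
    simp only [Finset.mem_filter, Finset.mem_univ, true_and, Pi.add_apply, Pi.smul_apply,
      smul_eq_mul] at hv ⊢
    refine ⟨fun r hr => by rw [hv.1 r hr, hsupp r hr]; simp, ?_⟩
    rw [hv.2]; field_simp; ring
  · intro v _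
    rw [add_assoc, ← add_smul, ← add_div]; simp
  · intro v _
    rw [add_assoc, ← add_smul, ← add_div]; simp
  · intro v _
    exact (colWeight_add θ x k v _ (hsmul _)).symm

lemma leadSum_eq_of_leadSum_ne_zero (θ : AddChar F ℂ) {x : Mat n F}
    (hx : ∀ r l : Fin n, l ≤ r → x r l = 0) {i k l : Fin n} (hik : i < k) (hkl : k < l)
    {t : F} (ht : t ≠ 0) (hne : leadSum θ x i l t ≠ 0) (s s' : F) :
    leadSum θ x i k s = leadSum θ x i k s' := by
  obtain ⟨w, hw, hne⟩ := Finset.exists_ne_zero_of_sum_ne_zero hne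
  simp only [Finset.mem_filter, Finset.mem_univ, true_and] at hw
  have hcond : ∀ c < l, (w ᵥ* x) c = 0 := by
    by_contra h
    exact hne (if_neg h)
  refine leadSum_eq_of_vecMul θ x (w := fun r => if r < k then w r else 0) ?_ ?_ ?_ s s'
  · rintro r (hr | hr)
    · simp [hw.1 r (Or.inl hr)]
    · simp [not_lt_of_ge hr]
  · simpa [hik, hw.2] using ht
  · intro c hc
    rw [← hcond c (hc.trans_lt hkl)]
    simp only [Matrix.vecMul, dotProduct]
    refine Finset.sum_congr rfl fun r _ => ?_
    by_cases hr : r < k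
    · rw [if_pos hr]
    · rw [hx r c (hc.trans (not_lt.1 hr)), mul_zero, mul_zero]

lemma colSum_mul_tailSum (θ : AddChar F ℂ) {x : Mat n F}
    (hx : ∀ r l : Fin n, l ≤ r → x r l = 0) {i k l : Fin n} (hik : i < k) (hkl : k < l)
    {t : F} (ht : t ≠ 0) :
    colSum θ x l (Pi.single i t) * tailSum θ x i.val k =
      (Fintype.card F : ℂ) * (colSum θ x l (Pi.single i t) * tailSum θ x (i.val + 1) k) := by
  rw [colSum_single θ x (hik.trans hkl) ht]
  by_cases h : leadSum θ x i l t = 0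
  · simp [h]
  · rw [tailSum_eq_sum_leadSum, Finset.sum_congr rfl fun s _ =>
      leadSum_eq_of_leadSum_ne_zero θ hx hik hkl ht h s 0, leadSum_zero θ x i k]
    simp only [Finset.sum_const, Finset.card_univ, nsmul_eq_mul]
    ring

lemma colSum_mul_colSum (θ : AddChar F ℂ) {x : Mat n F}
    (hx : ∀ r l : Fin n, l ≤ r → x r l = 0) {i j k : Fin n} (hij : i < j) (hjk : j < k)
    {s t : F} (hs : s ≠ 0) (ht : t ≠ 0) :
    colSum θ x j (Pi.single i s) * colSum θ x k (Pi.single i t) =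
      tailSum θ x (i.val + 1) j * colSum θ x k (Pi.single i t) := by
  rw [colSum_single θ x (hij.trans hjk) ht, colSum_single θ x hij hs]
  by_cases h : leadSum θ x i k t = 0
  · simp [h]
  · rw [leadSum_eq_of_leadSum_ne_zero θ hx hij hjk ht h s 0, leadSum_zero θ x i j]

lemma colSum_single_eq_tailSum (θ : AddChar F ℂ) {x : Mat n F} {i k : Fin n} (hik : i < k)
    (hi : ∀ l, x i l = 0) {t : F} (ht : t ≠ 0) :
    colSum θ x k (Pi.single i t) = tailSum θ x (i.val + 1) k := by
  rw [colSum_single θ x hik ht, ← leadSum_zero θ x i k]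
  refine leadSum_eq_of_vecMul θ x (w := Pi.single i 1) ?_ (by simp) ?_ t 0
  · rintro r (hr | hr)
    · exact Pi.single_eq_of_ne hr.ne _
    · exact Pi.single_eq_of_ne (hik.trans_le hr).ne' _
  · intro l _
    simp [hi l]

/-- The product of the column factors: the supercharacter value at `1 + x`. -/
noncomputable def colProd (θ : AddChar F ℂ) (x lam : Mat n F) : ℂ :=
  ∏ j, colSum θ x j fun i => lam i j

lemma colProd_of_col_eq_zero (θ : AddChar F ℂ) (x : Mat n F) {lam lam' : Mat n F} (k : Fin n)
    (h : ∀ i j, j ≠ k → lam' i j = lam i j) (hk : ∀ i, lam i k = 0) :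
    colProd θ x lam' = colProd θ x lam * colSum θ x k fun i => lam' i k := by
  unfold colProd
  rw [← Finset.mul_prod_erase _ _ (Finset.mem_univ k),
    ← Finset.mul_prod_erase _ (fun j => colSum θ x j fun i => lam i j) (Finset.mem_univ k)]
  have h0 : (fun i => lam i k) = 0 := funext hk
  rw [h0, colSum_zero, one_mul, mul_comm]
  congr 1
  refine Finset.prod_congr rfl fun j hj => ?_
  rw [funext fun i => h i j (Finset.ne_of_mem_erase hj)]

lemma updEnt_apply (A : Mat n F) (i j p q : Fin n) (t : F) :
    updEnt A i j t p q = if p = i ∧ q = j then t else A p q := rfl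

lemma updEnt_zero_mem_Sset {lam : Mat n F} (hlam : lam ∈ Sset n F) (i j : Fin n) :
    updEnt lam i j 0 ∈ Sset n F := by
  have hle : ∀ p q, updEnt lam i j 0 p q ≠ 0 → lam p q ≠ 0 := by
    intro p q h
    rw [updEnt_apply] at h
    split_ifs at h
    · exact absurd rfl h
    · exact h
  refine ⟨fun p q h => ?_, fun p q q' h h' => hlam.2.1 p q q' (hle _ _ h) (hle _ _ h'),
    fun p p' q h h' => hlam.2.2 p p' q (hle _ _ h) (hle _ _ h')⟩
  by_contra hc
  exact hle _ _ hc (hlam.1 p q h)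

lemma updEnt_mem_Sset {lam : Mat n F} (hlam : lam ∈ Sset n F) {i k : Fin n} (hik : i < k)
    (hrow : ∀ l, lam i l = 0) (hcol : ∀ l, lam l k = 0) (t : F) :
    updEnt lam i k t ∈ Sset n F := by
  have hcases : ∀ p q, updEnt lam i k t p q ≠ 0 →
      (p = i ∧ q = k) ∨ (p ≠ i ∧ q ≠ k ∧ lam p q ≠ 0) := by
    intro p q h
    rw [updEnt_apply] at h
    split_ifs at h with hpq
    · exact Or.inl hpq
    · refine Or.inr ⟨?_, ?_, h⟩
      · rintro rfl; exact h (hrow q)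
      · rintro rfl; exact h (hcol p)
  refine ⟨fun p q h => ?_, fun p q q' h h' => ?_, fun p p' q h h' => ?_⟩
  · by_contra hc
    rcases hcases p q hc with ⟨rfl, rfl⟩ | ⟨-, -, h'⟩
    · exact h hik
    · exact h' (hlam.1 p q h)
  · rcases hcases p q h with ⟨hp, hq⟩ | ⟨hp, hq, hne⟩ <;>
      rcases hcases p q' h' with ⟨hp', hq'⟩ | ⟨hp', hq', hne'⟩
    · rw [hq, hq']
    · exact absurd hp hp'
    · exact absurd hp' hp
    · exact hlam.2.1 p q q' hne hne'
  · rcases hcases p q h with ⟨hp, hq⟩ | ⟨hp, hq, hne⟩ <;>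
      rcases hcases p' q h' with ⟨hp', hq'⟩ | ⟨hp', hq', hne'⟩
    · rw [hp, hp']
    · exact absurd hq hq'
    · exact absurd hq' hq
    · exact hlam.2.2 p p' q hne hne'

lemma starProd_self (lam : Mat n F) (k : ℕ) : starProd lam k k = Finsupp.single lam 1 := by
  rw [starProd, if_pos rfl]

lemma starProd_of_right {lam : Mat n F} {i k l : Fin n} (hik : i < k) (hkl : k < l)
    (h : lam i l ≠ 0) :
    starProd lam i.val k.val = Fintype.card F • starProd lam (i.val + 1) k.val := by
  rw [starProd, if_neg (by have : i.val < k.val := hik; omega), dif_pos ⟨hik, k.isLt⟩]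
  exact if_pos ⟨l, hkl, h⟩

lemma starProd_of_same {lam : Mat n F} {i k : Fin n} (hik : i < k)
    (hno : ∀ l, k < l → lam i l = 0) (h : lam i k ≠ 0) :
    starProd lam i.val k.val = starProd (updEnt lam i k 0) (i.val + 1) k.val := by
  rw [starProd, if_neg (by have : i.val < k.val := hik; omega), dif_pos ⟨hik, k.isLt⟩]
  exact (if_neg (by rintro ⟨l, hl, hne⟩; exact hne (hno l hl))).trans (if_pos h)

lemma starProd_of_left {lam : Mat n F} (hlam : lam ∈ Sset n F) {i j k : Fin n} (hij : i < j)
    (hjk : j < k) (h : lam i j ≠ 0) :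
    starProd lam i.val k.val = starProd lam (i.val + 1) k.val +
      ∑ t ∈ Finset.univ \ {(0 : F)},
        starProd (updEnt (updEnt lam i j 0) i k t) (i.val + 1) j.val := by
  have hik := hij.trans hjk
  have huniq : ∀ l, lam i l ≠ 0 → l = j := fun l hl => hlam.2.1 _ _ _ hl h
  have hex : ∃ j : Fin n, i.val < j.val ∧ j.val < k.val ∧ lam i j ≠ 0 := ⟨j, hij, hjk, h⟩
  have hch : Classical.choose hex = j := huniq _ (Classical.choose_spec hex).2.2
  rw [starProd, if_neg (by have : i.val < k.val := hik; omega), dif_pos ⟨hik, k.isLt⟩]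
  refine (if_neg ?_).trans ((if_neg ?_).trans ((dif_pos hex).trans ?_))
  · rintro ⟨l, hl, hne⟩
    rw [huniq l hne] at hl
    exact absurd hl (not_lt_of_gt hjk)
  · intro hne
    exact hjk.ne' (huniq _ hne)
  · rw [hch]

lemma starProd_of_zero {lam : Mat n F} {i k : Fin n} (hik : i < k) (h : ∀ l, lam i l = 0) :
    starProd lam i.val k.val = starProd lam (i.val + 1) k.val +
      ∑ t ∈ Finset.univ \ {(0 : F)}, Finsupp.single (updEnt lam i k t) 1 := by
  rw [starProd, if_neg (by have : i.val < k.val := hik; omega), dif_pos ⟨hik, k.isLt⟩]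
  refine (if_neg ?_).trans ((if_neg ?_).trans (dif_neg ?_))
  · rintro ⟨l, -, hne⟩
    exact hne (h l)
  · exact fun hne => hne (h k)
  · rintro ⟨l, -, -, hne⟩
    exact hne (h l)

/-- Evaluation of a formal combination of matrices through `colProd`. -/
noncomputable def colProdSum (θ : AddChar F ℂ) (x : Mat n F) : (Mat n F →₀ ℕ) →+ ℂ :=
  Finsupp.liftAddHom fun mu =>
    (AddMonoidHom.mulRight (colProd θ x mu)).comp (Nat.castAddMonoidHom ℂ)

lemma colProdSum_apply (θ : AddChar F ℂ) (x : Mat n F) (f : Mat n F →₀ ℕ) :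
    colProdSum θ x f = ∑ mu ∈ f.support, (f mu : ℂ) * colProd θ x mu := rfl

lemma colProdSum_single (θ : AddChar F ℂ) (x : Mat n F) (mu : Mat n F) :
    colProdSum θ x (Finsupp.single mu 1) = colProd θ x mu := by
  simp [colProdSum]

lemma fun_updEnt_same {lam : Mat n F} {i k : Fin n} (hcol : ∀ l, l ≠ i → lam l k = 0) (t : F) :
    (fun l => updEnt lam i k t l k) = Pi.single i t := by
  funext l
  by_cases hl : l = i
  · subst hl; simp [updEnt_apply]
  · simp [updEnt_apply, hl, hcol l hl]

lemma colProd_updEnt (θ : AddChar F ℂ) (x : Mat n F) {lam : Mat n F} (i k : Fin n)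
    (hcol : ∀ l, lam l k = 0) (t : F) :
    colProd θ x (updEnt lam i k t) = colProd θ x lam * colSum θ x k (Pi.single i t) := by
  rw [colProd_of_col_eq_zero θ x k (lam := lam) (fun p q hq => by simp [updEnt_apply, hq]) hcol,
    fun_updEnt_same (fun l _ => hcol l)]

lemma col_updEnt_zero {lam : Mat n F} (hlam : lam ∈ Sset n F) {i j : Fin n} (h : lam i j ≠ 0)
    (l : Fin n) : updEnt lam i j 0 l j = 0 := by
  by_cases hl : l = i
  · simp [updEnt_apply, hl]
  · simp only [updEnt_apply, hl, false_and, if_false]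
    by_contra hc
    exact hl (hlam.2.2 _ _ _ hc h)

lemma row_updEnt_zero {lam : Mat n F} (hlam : lam ∈ Sset n F) {i j : Fin n} (h : lam i j ≠ 0)
    (l : Fin n) : updEnt lam i j 0 i l = 0 := by
  by_cases hl : l = j
  · simp [updEnt_apply, hl]
  · simp only [updEnt_apply, hl, and_false, if_false]
    by_contra hc
    exact hl (hlam.2.1 _ _ _ hc h)

lemma colProd_eq_updEnt_zero_mul (θ : AddChar F ℂ) (x : Mat n F) {lam : Mat n F}
    (hlam : lam ∈ Sset n F) {i j : Fin n} (h : lam i j ≠ 0) :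
    colProd θ x lam =
      colProd θ x (updEnt lam i j 0) * colSum θ x j (Pi.single i (lam i j)) := by
  rw [← colProd_updEnt θ x i j (col_updEnt_zero hlam h)]
  congr 1
  ext p q
  simp only [updEnt_apply]
  split_ifs with hpq
  · rw [hpq.1, hpq.2]
  · rfl

lemma col_updEnt_updEnt {lam : Mat n F} (hlam : lam ∈ Sset n F) {i j k : Fin n}
    (h : lam i j ≠ 0) (hjk : j ≠ k) (t : F) (l : Fin n) :
    updEnt (updEnt lam i j 0) i k t l j = 0 := by
  rw [updEnt_apply, if_neg (fun hc => hjk hc.2), col_updEnt_zero hlam h]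

lemma updEnt_updEnt_mem_Sset {lam : Mat n F} (hlam : lam ∈ Sset n F) {i j k : Fin n}
    (hik : i < k) (h : lam i j ≠ 0) (hk : ∀ l, lam l k = 0) (t : F) :
    updEnt (updEnt lam i j 0) i k t ∈ Sset n F := by
  refine updEnt_mem_Sset (updEnt_zero_mem_Sset hlam i j) hik (row_updEnt_zero hlam h) (fun l => ?_) t
  rw [updEnt_apply, hk l, ite_self]

/-- All matrices occurring in `starProd lam i k` lie in `Sset` and agree with `lam` in the rows
above `i`. -/
lemma starProd_mem_supported (d : ℕ) : ∀ (lam : Mat n F) (i : ℕ) (k : Fin n), i + d = k.val →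
    lam ∈ Sset n F → (∀ l, lam l k = 0) →
    starProd lam i k.val ∈
      Finsupp.supported ℕ ℕ {mu | mu ∈ Sset n F ∧ ∀ r j, r.val < i → mu r j = lam r j} := by
  induction d using Nat.strong_induction_on with
  | _ d ih =>
    intro lam i k hd hlam hk
    rcases Nat.eq_zero_or_pos d with rfl | hdpos
    · obtain rfl : i = k.val := by omega
      rw [starProd_self]
      exact Finsupp.single_mem_supported ℕ 1 ⟨hlam, fun _ _ _ => rfl⟩
    · obtain ⟨i, rfl⟩ : ∃ i' : Fin n, i'.val = i := ⟨⟨i, by have := k.isLt; omega⟩, rfl⟩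
      have hik : i < k := by rw [Fin.lt_def]; omega
      have hrec : starProd lam (i.val + 1) k.val ∈ Finsupp.supported ℕ ℕ
          {mu | mu ∈ Sset n F ∧ ∀ r j, r.val < i.val → mu r j = lam r j} := by
        refine Finsupp.supported_mono ?_ (ih (d - 1) (by omega) lam (i.val + 1) k (by omega) hlam hk)
        rintro mu ⟨h1, h2⟩
        exact ⟨h1, fun r j hr => h2 r j (by omega)⟩
      by_cases hz : ∀ l, lam i l = 0
      · rw [starProd_of_zero hik hz]
        refine add_mem hrec (sum_mem fun t _ => Finsupp.single_mem_supported ℕ 1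
          ⟨updEnt_mem_Sset hlam hik hz hk t, fun r j hr => ?_⟩)
        rw [updEnt_apply, if_neg]
        rintro ⟨rfl, -⟩
        exact lt_irrefl _ hr
      · push Not at hz
        obtain ⟨j, hj⟩ := hz
        have hij : i < j := by by_contra hc; exact hj (hlam.1 i j hc)
        have hjk : j ≠ k := by rintro rfl; exact hj (hk i)
        rcases lt_or_gt_of_ne hjk with hjk' | hkj
        · rw [starProd_of_left hlam hij hjk' hj]
          refine add_mem hrec (sum_mem fun t _ => ?_)
          have hij' : i.val < j.val := hij
          refine Finsupp.supported_mono ?_ (ih (j.val - (i.val + 1))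
            (by have : j.val < k.val := hjk'; omega) _ (i.val + 1) j (by omega)
            (updEnt_updEnt_mem_Sset hlam hik hj hk t) (col_updEnt_updEnt hlam hj hjk t))
          rintro mu ⟨h1, h2⟩
          refine ⟨h1, fun r l hr => ?_⟩
          have hri : r ≠ i := by rintro rfl; exact lt_irrefl _ hr
          rw [h2 r l (by omega)]
          simp [updEnt_apply, hri]
        · rw [starProd_of_right hik hkj hj]
          exact Submodule.smul_mem _ _ hrec

lemma colProdSum_starProd (θ : AddChar F ℂ) {x : Mat n F}
    (hx : ∀ r l : Fin n, l ≤ r → x r l = 0) (d : ℕ) :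
    ∀ (lam : Mat n F) (i : ℕ) (k : Fin n), i + d = k.val → lam ∈ Sset n F →
      (∀ l, lam l k = 0) →
      colProdSum θ x (starProd lam i k.val) = colProd θ x lam * tailSum θ x i k := by
  induction d using Nat.strong_induction_on with
  | _ d ih =>
    intro lam i k hd hlam hk
    rcases Nat.eq_zero_or_pos d with rfl | hdpos
    · obtain rfl : i = k.val := by omega
      rw [starProd_self, colProdSum_single, tailSum_self, mul_one]
    · obtain ⟨i, rfl⟩ : ∃ i' : Fin n, i'.val = i := ⟨⟨i, by have := k.isLt; omega⟩, rfl⟩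
      have hik : i < k := by rw [Fin.lt_def]; omega
      have hrec := ih (d - 1) (by omega) lam (i.val + 1) k (by omega) hlam hk
      by_cases hz : ∀ l, lam i l = 0
      · rw [starProd_of_zero hik hz, map_add, map_sum, hrec, tailSum_succ θ x hik, mul_add,
          Finset.mul_sum]
        congr 1
        refine Finset.sum_congr rfl fun t _ => ?_
        rw [colProdSum_single, colProd_updEnt θ x i k hk]
      · push Not at hz
        obtain ⟨j, hj⟩ := hz
        have hij : i < j := by by_contra hc; exact hj (hlam.1 i j hc)
        have hjk : j ≠ k := by rintro rfl; exact hj (hk i)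
        rcases lt_or_gt_of_ne hjk with hjk' | hkj
        · rw [starProd_of_left hlam hij hjk' hj, map_add, map_sum, hrec, tailSum_succ θ x hik,
            mul_add, Finset.mul_sum]
          congr 1
          refine Finset.sum_congr rfl fun t ht => ?_
          have ht : t ≠ 0 := by simpa using ht
          have hij' : i.val < j.val := hij
          rw [ih (j.val - (i.val + 1)) (by have : j.val < k.val := hjk'; omega) _ (i.val + 1) j
            (by omega) (updEnt_updEnt_mem_Sset hlam hik hj hk t) (col_updEnt_updEnt hlam hj hjk t),
            colProd_updEnt θ x i k fun l => by rw [updEnt_apply, hk l, ite_self],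
            colProd_eq_updEnt_zero_mul θ x hlam hj, mul_assoc, mul_assoc,
            colSum_mul_colSum θ hx hij hjk' hj ht, mul_comm (tailSum θ x _ j)]
        · rw [starProd_of_right hik hkj hj, map_nsmul, hrec,
            colProd_eq_updEnt_zero_mul θ x hlam hj, mul_assoc, mul_assoc,
            colSum_mul_tailSum θ hx hik hkj hj, nsmul_eq_mul]
          ring

end Aux

/-- Restriction from `U_n` to `U_{n−1} ≅ U_(n)` (matrices with zero first
row).  If `λ ∈ 𝒮_n(q)` has `λ_{1k} ≠ 0` (0-based: `lam 0 k0 ≠ 0`), then every matrix occurring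
in `λ ∗_1 {k}` has zero first row, and `Res^{U_n}_{U_(n)} χ^λ = Σ_μ c_μ χ^μ` where
`λ ∗_1 {k} = Σ_μ c_μ μ`.  If the first row of `λ` is zero, the restriction is the
`U_(n)`-supercharacter attached to `λ` itself. -/
theorem stmt19 {n : ℕ} (hn : 2 ≤ n) {F : Type*} [Field F] [Fintype F]
    (θ : AddChar F ℂ) (hθ : ∃ x, θ x ≠ 1)
    (lam : Mat n F) (hlam : lam ∈ Sset n F) :
    (∀ k0 : Fin n, lam ⟨0, by omega⟩ k0 ≠ 0 →
      (∀ mu ∈ (starProd lam 0 k0.val).support, ∀ j : Fin n, mu ⟨0, by omega⟩ j = 0) ∧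
        ∀ u ∈ (patGroup (Pm n n) : Set (Mat n F)),
          superChar (Plt n) θ lam u =
            ∑ mu ∈ (starProd lam 0 k0.val).support,
              ((starProd lam 0 k0.val) mu : ℂ) * superChar (Pm n n) θ mu u) ∧
    ((∀ j : Fin n, lam ⟨0, by omega⟩ j = 0) →
      ∀ u ∈ (patGroup (Pm n n) : Set (Mat n F)),
        superChar (Plt n) θ lam u = superChar (Pm n n) θ lam u) := by
  rw [Plt_eq_rowPat, Pm_eq_rowPat]
  have hle : ∀ u ∈ (patGroup (rowPat n 1) : Set (Mat n F)), u ∈ patGroup (rowPat n 0) :=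
    fun u hu => ⟨hu.1, fun i j hij hP => hu.2 i j hij fun h => hP ⟨h.1, Nat.zero_le _⟩⟩
  refine ⟨fun k0 hk0 => ?_, fun hrow u hu => ?_⟩
  · set z : Fin n := ⟨0, by omega⟩ with hz
    have hzk : z < k0 := by by_contra hc; exact hk0 (hlam.1 _ _ hc)
    have hzk' : 0 < k0.val := hzk
    have hstar : starProd lam 0 k0.val = starProd (updEnt lam z k0 0) 1 k0.val :=
      starProd_of_same (i := z) hzk
        (fun l hl => by by_contra hc; exact hl.ne' (hlam.2.1 _ _ _ hc hk0)) hk0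
    have hmem := updEnt_zero_mem_Sset hlam z k0
    have hcol := col_updEnt_zero hlam hk0
    have hsupp : ∀ mu ∈ (starProd lam 0 k0.val).support,
        mu ∈ Sset n F ∧ ∀ j, mu z j = 0 := by
      intro mu hmu
      have h := starProd_mem_supported (k0.val - 1) _ 1 k0 (by omega) hmem hcol
      rw [← hstar, Finsupp.mem_supported] at h
      obtain ⟨h1, h2⟩ := h hmu
      exact ⟨h1, fun j => (h2 z j (by simp [hz])).trans (row_updEnt_zero hlam hk0 j)⟩
    refine ⟨fun mu hmu => (hsupp mu hmu).2, fun u hu => ?_⟩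
    have hx := mem_patGroup_iff.1 hu
    rw [superChar_eq_prod θ hθ (hle u hu) hlam (by simp)]
    have hsum : ∑ mu ∈ (starProd lam 0 k0.val).support,
        ((starProd lam 0 k0.val) mu : ℂ) * superChar (rowPat n 1) θ mu u =
        colProdSum θ (u - 1) (starProd lam 0 k0.val) := by
      rw [colProdSum_apply]
      refine Finset.sum_congr rfl fun mu hmu => ?_
      rw [superChar_eq_prod θ hθ hu (hsupp mu hmu).1, colProd]
      intro i j hi
      obtain rfl : i = z := Fin.ext (by simp [hz]; omega)
      exact (hsupp mu hmu).2 j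
    rw [hsum, hstar, colProdSum_starProd θ (fun r l hlr => hx r l fun h => not_lt_of_ge hlr h.1)
      (k0.val - 1) _ 1 k0 (by omega) hmem hcol]
    refine (colProd_eq_updEnt_zero_mul θ (u - 1) hlam hk0).trans ?_
    rw [colSum_single_eq_tailSum θ hzk (fun l => hx z l fun h => by simpa [hz] using h.2) hk0]
  · rw [superChar_eq_prod θ hθ (hle u hu) hlam (by simp), superChar_eq_prod θ hθ hu hlam]
    intro i j hi
    rw [show i = ⟨0, by omega⟩ from Fin.ext (by simp; omega)]
    exact hrow j
end
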